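/- Let n ≥ 1 and k = [n/2]+1. Let σ : ℤⁿ → ℂ be a symbol such that for every multi-index α with |α| ≤ k there is C_α > 0 with |Δ_ξ^α σ(ξ)| ≤ C_α ⟨ξ⟩^{−|α|} for all ξ ∈ ℤⁿ. Then for every 0 < p < 1 the periodic Fourier multiplier σ(D) is bounded from L¹(𝕋ⁿ) into L^p(𝕋ⁿ), i.e. there is C > 0 such that (∫_{𝕋ⁿ} |σ(D)f(x)|^p dx)^{1/p} ≤ C ‖f‖_{L¹(𝕋ⁿ)} for all smooth f. -/

import Mathlib

open MeasureTheory Real ENNReal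

noncomputable section

/-- Partial derivative of a complex-valued function on `ℝⁿ` in the `j`-th coordinate
direction. -/
def pd {n : ℕ} (j : Fin n) (f : (Fin n → ℝ) → ℂ) : (Fin n → ℝ) → ℂ :=
  fun x => fderiv ℝ f x (Pi.single j 1)

/-- The canonical list of directions associated to a multi-index `β ∈ ℕⁿ`. -/
def mIdxList {n : ℕ} (β : Fin n → ℕ) : List (Fin n) :=
  (List.finRange n).flatMap fun j => List.replicate (β j) j

/-- Iterated partial derivative `∂^β` associated to a multi-index `β`. -/
def pdM {n : ℕ} (β : Fin n → ℕ) (f : (Fin n → ℝ) → ℂ) : (Fin n → ℝ) → ℂ :=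
  (mIdxList β).foldr pd f

/-- Forward difference operator in the `j`-th direction on functions of `ξ ∈ ℤⁿ`. -/
def dd {n : ℕ} (j : Fin n) (g : (Fin n → ℤ) → ℂ) : (Fin n → ℤ) → ℂ :=
  fun ξ => g (ξ + Pi.single j 1) - g ξ

/-- Iterated difference operator `Δ_ξ^α` associated to a multi-index `α`. -/
def ddM {n : ℕ} (α : Fin n → ℕ) (g : (Fin n → ℤ) → ℂ) : (Fin n → ℤ) → ℂ :=
  (mIdxList α).foldr dd g

/-- Japanese bracket `⟨ξ⟩ = (1+|ξ|²)^{1/2}` of a lattice point `ξ ∈ ℤⁿ`. -/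
def jb {n : ℕ} (ξ : Fin n → ℤ) : ℝ := Real.sqrt (1 + ∑ j, ((ξ j : ℝ)) ^ 2)

/-- Japanese bracket `⟨ξ⟩ = (1+|ξ|²)^{1/2}` of a vector `ξ ∈ ℝⁿ`. -/
def jbR {n : ℕ} (ξ : Fin n → ℝ) : ℝ := Real.sqrt (1 + ∑ j, (ξ j) ^ 2)

/-- The canonical embedding `ℤⁿ → ℝⁿ`. -/
def castZ {n : ℕ} (ξ : Fin n → ℤ) : Fin n → ℝ := fun j => (ξ j : ℝ)

/-- The fundamental domain `[0,1)ⁿ` of the torus `𝕋ⁿ = ℝⁿ/ℤⁿ`. -/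
def cube (n : ℕ) : Set (Fin n → ℝ) := Set.univ.pi fun _ => Set.Ico (0 : ℝ) 1

/-- The normalized Lebesgue measure of the torus `𝕋ⁿ`, realized as the Lebesgue measure
on `ℝⁿ` restricted to the fundamental domain `[0,1)ⁿ`. -/
def μT (n : ℕ) : Measure (Fin n → ℝ) := volume.restrict (cube n)

/-- `1`-periodicity of a function on `ℝⁿ` (i.e. the function descends to `𝕋ⁿ`). -/
def Per {n : ℕ} (f : (Fin n → ℝ) → ℂ) : Prop :=
  ∀ (x : Fin n → ℝ) (v : Fin n → ℤ), f (x + fun j => (v j : ℝ)) = f x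

/-- The character `e^{2πi⟨x,ξ⟩}`. -/
def eChar {n : ℕ} (x : Fin n → ℝ) (ξ : Fin n → ℤ) : ℂ :=
  Complex.exp (2 * (π : ℂ) * Complex.I * ∑ j, (x j : ℂ) * (ξ j : ℂ))

/-- Fourier coefficient `f̂(ξ) = ∫_{𝕋ⁿ} e^{-2πi⟨x,ξ⟩} f(x) dx` of a function on `𝕋ⁿ`. -/
def fc {n : ℕ} (f : (Fin n → ℝ) → ℂ) (ξ : Fin n → ℤ) : ℂ :=
  ∫ x, Complex.exp (-(2 * (π : ℂ) * Complex.I) * ∑ j, (x j : ℂ) * (ξ j : ℂ)) * f x ∂(μT n)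

/-- Periodic pseudo-differential operator
    `σ(x,D)f(x) = Σ_{ξ ∈ ℤⁿ} e^{2πi⟨x,ξ⟩} σ(x,ξ) f̂(ξ)`
with symbol `σ` on `𝕋ⁿ × ℤⁿ`. -/
def Op {n : ℕ} (σ : (Fin n → ℝ) → (Fin n → ℤ) → ℂ) (f : (Fin n → ℝ) → ℂ) :
    (Fin n → ℝ) → ℂ :=
  fun x => ∑' ξ : Fin n → ℤ, eChar x ξ * σ x ξ * fc f ξ

/-- The `L^p(𝕋ⁿ)` norm, for a real exponent `p`. -/
def lpT (n : ℕ) (p : ℝ) (g : (Fin n → ℝ) → ℂ) : ℝ :=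
  (∫ x, ‖g x‖ ^ p ∂(μT n)) ^ (1 / p)

/-- `∂_x^β Δ_ξ^α σ(x,ξ)` for a symbol `σ` on `𝕋ⁿ × ℤⁿ` (difference operator applied first,
then the derivatives in `x`). -/
def symbDxD {n : ℕ} (β α : Fin n → ℕ) (σ : (Fin n → ℝ) → (Fin n → ℤ) → ℂ)
    (x : Fin n → ℝ) (ξ : Fin n → ℤ) : ℂ :=
  pdM β (fun x' => ddM α (σ x') ξ) x

/-- `Δ_ξ^α ∂_x^β σ(x,ξ)` for a symbol `σ` on `𝕋ⁿ × ℤⁿ` (derivatives in `x` applied first,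
then the difference operator in `ξ`). -/
def symbDDx {n : ℕ} (α β : Fin n → ℕ) (σ : (Fin n → ℝ) → (Fin n → ℤ) → ℂ)
    (x : Fin n → ℝ) (ξ : Fin n → ℤ) : ℂ :=
  ddM α (fun ξ' => pdM β (fun x' => σ x' ξ') x) ξ

/-- `∂_ξ^α ∂_x^β σ(x,ξ)` for a symbol `σ` on `𝕋ⁿ × ℝⁿ` (derivatives in `x` applied first,
then the derivatives in `ξ`). -/
def symbDξDx {n : ℕ} (α β : Fin n → ℕ) (σ : (Fin n → ℝ) → (Fin n → ℝ) → ℂ)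
    (x ξ : Fin n → ℝ) : ℂ :=
  pdM α (fun ξ' => pdM β (fun x' => σ x' ξ') x) ξ

/-- `∂_x^β ∂_ξ^α σ(x,ξ)` for a symbol `σ` on `𝕋ⁿ × ℝⁿ` (derivatives in `ξ` applied first,
then the derivatives in `x`). -/
def symbDxDξ {n : ℕ} (β α : Fin n → ℕ) (σ : (Fin n → ℝ) → (Fin n → ℝ) → ℂ)
    (x ξ : Fin n → ℝ) : ℂ :=
  pdM β (fun x' => pdM α (σ x') ξ) x

/-- The Euclidean Fourier transform `û(ξ) = ∫_{ℝⁿ} e^{-2πi⟨x,ξ⟩} u(x) dx`. -/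
def FT {n : ℕ} (u : (Fin n → ℝ) → ℂ) (ξ : Fin n → ℝ) : ℂ :=
  ∫ x, Complex.exp (-(2 * (π : ℂ) * Complex.I) * ∑ j, (x j : ℂ) * (ξ j : ℂ)) * u x

/-- Pseudo-differential operator on `ℝⁿ`:
`T_σ u(x) = ∫_{ℝⁿ} e^{2πi⟨x,ξ⟩} σ(x,ξ) û(ξ) dξ`. -/
def OpR {n : ℕ} (σ : (Fin n → ℝ) → (Fin n → ℝ) → ℂ) (u : (Fin n → ℝ) → ℂ) :
    (Fin n → ℝ) → ℂ :=
  fun x => ∫ ξ, Complex.exp (2 * (π : ℂ) * Complex.I * ∑ j, (x j : ℂ) * (ξ j : ℂ)) * σ x ξ * FT u ξ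

/-- Periodic amplitude operator
`a(x,y,D)u(x) = ∫_{𝕋ⁿ} ∫_{ℝⁿ} e^{2πi⟨x-y,ξ⟩} a(x,y,ξ) u(y) dξ dy`. -/
def OpAmp {n : ℕ} (a : (Fin n → ℝ) → (Fin n → ℝ) → (Fin n → ℝ) → ℂ)
    (u : (Fin n → ℝ) → ℂ) : (Fin n → ℝ) → ℂ :=
  fun x => ∫ y,
    (∫ ξ, Complex.exp (2 * (π : ℂ) * Complex.I * ∑ j, ((x j : ℂ) - (y j : ℂ)) * (ξ j : ℂ)) *
        a x y ξ) * u y ∂(μT n)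

/-- The `L^p(ℝⁿ)` norm, for a real exponent `p`. -/
def lpR (n : ℕ) (p : ℝ) (g : (Fin n → ℝ) → ℂ) : ℝ :=
  (∫ x, ‖g x‖ ^ p) ^ (1 / p)

section

variable {n : ℕ}

/-- The one-dimensional character `e^{2πit}`. -/
def unitExp (t : ℝ) : ℂ := Complex.exp (2 * (π : ℂ) * Complex.I * t)

lemma unitExp_add (s t : ℝ) : unitExp (s + t) = unitExp s * unitExp t := by
  rw [unitExp, unitExp, unitExp, ← Complex.exp_add]; push_cast; ring_nf

lemma unitExp_eq (t : ℝ) : unitExp t = Complex.exp (Complex.I * (2 * π * t : ℝ)) := by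
  rw [unitExp]; push_cast; ring_nf

lemma norm_unitExp (t : ℝ) : ‖unitExp t‖ = 1 := by
  rw [unitExp_eq, mul_comm, Complex.norm_exp_ofReal_mul_I]

lemma unitExp_zero : unitExp 0 = 1 := by simp [unitExp]

lemma unitExp_int (k : ℤ) : unitExp k = 1 := by
  rw [unitExp]
  convert Complex.exp_int_mul_two_pi_mul_I k using 2
  push_cast; ring

lemma unitExp_periodic : Function.Periodic unitExp 1 := fun t => by
  have h := unitExp_int 1
  rw [Int.cast_one] at h
  rw [unitExp_add, h, mul_one]

lemma continuous_unitExp : Continuous unitExp := by unfold unitExp; fun_prop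

lemma norm_unitExp_sub_one_le (t : ℝ) : ‖unitExp t - 1‖ ≤ 2 * π * |t| := by
  rw [unitExp_eq]
  refine norm_exp_I_mul_ofReal_sub_one_le.trans ?_
  rw [norm_mul, Real.norm_eq_abs, Real.norm_eq_abs, abs_of_pos Real.two_pi_pos]

lemma le_norm_unitExp_sub_one {t : ℝ} (ht : |t| ≤ 1 / 2) : |t| ≤ ‖unitExp t - 1‖ := by
  rw [unitExp_eq, Complex.norm_exp_I_mul_ofReal_sub_one, norm_mul, Real.norm_eq_abs,
    Real.norm_eq_abs, show 2 * π * t / 2 = π * t by ring]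
  have h := Real.mul_abs_le_abs_sin (x := π * t) (by
    rw [abs_mul, abs_of_pos pi_pos]; nlinarith [pi_pos])
  rw [abs_mul, abs_of_pos pi_pos] at h
  have : 2 / π * (π * |t|) = 2 * |t| := by field_simp
  rw [this] at h
  rw [abs_two]
  linarith [abs_nonneg t]

lemma norm_unitExp_sub_one_neg (t : ℝ) : ‖unitExp (-t) - 1‖ = ‖unitExp t - 1‖ := by
  have h : unitExp (-t) - 1 = -(unitExp (-t) * (unitExp t - 1)) := by
    rw [mul_sub, ← unitExp_add]; simp [unitExp_zero]
  rw [h, norm_neg, norm_mul, norm_unitExp, one_mul]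

lemma norm_unitExp_sub_one_add_le (s t : ℝ) :
    ‖unitExp (s + t) - 1‖ ≤ ‖unitExp s - 1‖ + ‖unitExp t - 1‖ := by
  have h : unitExp (s + t) - 1 = unitExp t * (unitExp s - 1) + (unitExp t - 1) := by
    rw [unitExp_add]; ring
  rw [h]
  refine (norm_add_le _ _).trans ?_
  rw [norm_mul, norm_unitExp, one_mul]

lemma eChar_eq_prod (x : Fin n → ℝ) (ξ : Fin n → ℤ) :
    eChar x ξ = ∏ j, unitExp (x j * ξ j) := by
  simp only [eChar, unitExp]
  rw [← Complex.exp_sum, Finset.mul_sum]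
  push_cast; rfl

lemma eChar_eq_unitExp (x : Fin n → ℝ) (ξ : Fin n → ℤ) :
    eChar x ξ = unitExp (∑ j, x j * ξ j) := by
  simp only [eChar, unitExp]; push_cast; rfl

lemma eChar_add_left (x y : Fin n → ℝ) (ξ : Fin n → ℤ) :
    eChar (x + y) ξ = eChar x ξ * eChar y ξ := by
  simp only [eChar_eq_unitExp, ← unitExp_add, Pi.add_apply, add_mul, Finset.sum_add_distrib]

lemma eChar_add_right (x : Fin n → ℝ) (ξ ζ : Fin n → ℤ) :
    eChar x (ξ + ζ) = eChar x ξ * eChar x ζ := by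
  simp only [eChar_eq_unitExp, ← unitExp_add, Pi.add_apply, Int.cast_add, mul_add,
    Finset.sum_add_distrib]

lemma eChar_single (x : Fin n → ℝ) (l : Fin n) : eChar x (Pi.single l 1) = unitExp (x l) := by
  rw [eChar_eq_unitExp, Finset.sum_eq_single l] <;> simp +contextual

lemma norm_eChar (x : Fin n → ℝ) (ξ : Fin n → ℤ) : ‖eChar x ξ‖ = 1 := by
  rw [eChar_eq_unitExp, norm_unitExp]

lemma eChar_neg_left (x : Fin n → ℝ) (ξ : Fin n → ℤ) : eChar (-x) ξ = eChar x (-ξ) := by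
  simp [eChar_eq_unitExp]

lemma eChar_zero_right (x : Fin n → ℝ) : eChar x 0 = 1 := by
  simp [eChar_eq_unitExp, unitExp_zero]

lemma eChar_sub_left (x y : Fin n → ℝ) (ξ : Fin n → ℤ) :
    eChar (x - y) ξ = eChar x ξ * eChar (-y) ξ := by
  rw [sub_eq_add_neg, eChar_add_left]

lemma star_eChar (x : Fin n → ℝ) (ξ : Fin n → ℤ) : star (eChar x ξ) = eChar x (-ξ) := by
  have h1 : eChar x ξ * eChar x (-ξ) = 1 := by
    rw [← eChar_add_right, add_neg_cancel, eChar_zero_right]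
  have h2 : eChar x ξ * star (eChar x ξ) = 1 := by
    rw [Complex.star_def, Complex.mul_conj, Complex.normSq_eq_norm_sq, norm_eChar]; simp
  have h0 : eChar x ξ ≠ 0 := by rw [← norm_ne_zero_iff, norm_eChar]; exact one_ne_zero
  exact mul_left_cancel₀ h0 (h2.trans h1.symm)

@[fun_prop]
lemma continuous_eChar (ξ : Fin n → ℤ) : Continuous fun x : Fin n → ℝ => eChar x ξ := by
  unfold eChar; fun_prop

lemma μT_eq_pi (n : ℕ) : μT n = Measure.pi fun _ => volume.restrict (Set.Ico (0 : ℝ) 1) := by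
  rw [μT, cube, volume_pi, Measure.restrict_pi_pi]

instance isProbabilityMeasure_μT (n : ℕ) : IsProbabilityMeasure (μT n) := by
  have : IsProbabilityMeasure (volume.restrict (Set.Ico (0 : ℝ) 1)) := ⟨by simp⟩
  rw [μT_eq_pi]; infer_instance

lemma measurableSet_cube (n : ℕ) : MeasurableSet (cube n) :=
  MeasurableSet.univ_pi fun _ => measurableSet_Ico

lemma cube_subset_Icc (n : ℕ) : cube n ⊆ Set.Icc 0 1 := fun _ hx =>
  ⟨fun j => (hx j trivial).1, fun j => (hx j trivial).2.le⟩

lemma Continuous.integrable_μT {E : Type*} [NormedAddCommGroup E] {F : (Fin n → ℝ) → E}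
    (hF : Continuous F) : Integrable F (μT n) :=
  (hF.continuousOn.integrableOn_compact isCompact_Icc).mono_set (cube_subset_Icc n)

lemma integral_Ico_unitExp (k : ℤ) :
    ∫ t in Set.Ico (0 : ℝ) 1, unitExp (t * k) = if k = 0 then 1 else 0 := by
  rw [integral_Ico_eq_integral_Ioc, ← intervalIntegral.integral_of_le zero_le_one]
  split_ifs with h
  · simp [h, unitExp_zero]
  · have hc : 2 * (π : ℂ) * Complex.I * k ≠ 0 := by
      simp [h, pi_ne_zero]
    have : ∀ t : ℝ, unitExp (t * k) = Complex.exp (2 * (π : ℂ) * Complex.I * k * t) := fun t => by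
      rw [unitExp]; push_cast; ring_nf
    simp_rw [this]
    rw [integral_exp_mul_complex hc]
    have h1 := unitExp_int k
    rw [unitExp] at h1
    push_cast at h1 ⊢
    rw [mul_one, h1]; simp

lemma integral_eChar (ξ : Fin n → ℤ) : ∫ x, eChar x ξ ∂μT n = if ξ = 0 then 1 else 0 := by
  simp_rw [eChar_eq_prod, μT_eq_pi]
  rw [integral_fintype_prod_eq_prod (f := fun j t => unitExp (t * (ξ j : ℤ)))]
  simp_rw [integral_Ico_unitExp]
  split_ifs with h
  · simp [h]
  · obtain ⟨j, hj⟩ := Function.ne_iff.1 h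
    exact Finset.prod_eq_zero (Finset.mem_univ j) (by simpa using hj)

/-- The trigonometric sum with coefficients `τ`. -/
def trigSum (τ : (Fin n → ℤ) → ℂ) (x : Fin n → ℝ) : ℂ := ∑' ξ, τ ξ * eChar x ξ

lemma trigSum_eq_sum {τ : (Fin n → ℤ) → ℂ} {S : Finset (Fin n → ℤ)} (hS : ∀ ξ ∉ S, τ ξ = 0)
    (x : Fin n → ℝ) : trigSum τ x = ∑ ξ ∈ S, τ ξ * eChar x ξ :=
  tsum_eq_sum fun ξ hξ => by rw [hS ξ hξ, zero_mul]

lemma continuous_trigSum {τ : (Fin n → ℤ) → ℂ} {S : Finset (Fin n → ℤ)}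
    (hS : ∀ ξ ∉ S, τ ξ = 0) : Continuous (trigSum τ) := by
  rw [funext (trigSum_eq_sum hS)]; fun_prop

lemma trigSum_sub_right (τ : (Fin n → ℤ) → ℂ) (x y : Fin n → ℝ) :
    trigSum τ (x - y) = trigSum (fun ξ => τ ξ * eChar (-y) ξ) x := by
  simp only [trigSum, eChar_sub_left]
  exact tsum_congr fun ξ => by ring

lemma trigSum_sub {τ τ' : (Fin n → ℤ) → ℂ} {S : Finset (Fin n → ℤ)} (hS : ∀ ξ ∉ S, τ ξ = 0)
    (hS' : ∀ ξ ∉ S, τ' ξ = 0) (x : Fin n → ℝ) :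
    trigSum τ x - trigSum τ' x = trigSum (fun ξ => τ ξ - τ' ξ) x := by
  rw [trigSum_eq_sum hS, trigSum_eq_sum hS', trigSum_eq_sum (S := S) (fun ξ hξ => by
    rw [hS ξ hξ, hS' ξ hξ, sub_zero]), ← Finset.sum_sub_distrib]
  exact Finset.sum_congr rfl fun ξ _ => by ring

lemma integral_norm_sq_sum_eChar (S : Finset (Fin n → ℤ)) (c : (Fin n → ℤ) → ℂ) :
    ∫ x, ‖∑ ξ ∈ S, c ξ * eChar x ξ‖ ^ 2 ∂μT n = ∑ ξ ∈ S, ‖c ξ‖ ^ 2 := by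
  have key : ∫ x, ((‖∑ ξ ∈ S, c ξ * eChar x ξ‖ ^ 2 : ℝ) : ℂ) ∂μT n
      = ((∑ ξ ∈ S, ‖c ξ‖ ^ 2 : ℝ) : ℂ) := by
    have h1 : ∀ x : Fin n → ℝ, ((‖∑ ξ ∈ S, c ξ * eChar x ξ‖ ^ 2 : ℝ) : ℂ)
        = ∑ ξ ∈ S, ∑ ζ ∈ S, (c ξ * star (c ζ)) * eChar x (ξ - ζ) := fun x => by
      rw [← Complex.normSq_eq_norm_sq, ← Complex.mul_conj, ← Complex.star_def, star_sum,
        Finset.sum_mul_sum]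
      refine Finset.sum_congr rfl fun ξ _ => Finset.sum_congr rfl fun ζ _ => ?_
      rw [star_mul', star_eChar, sub_eq_add_neg, eChar_add_right]; ring
    simp_rw [h1]
    rw [integral_finsetSum _ fun ξ _ => Continuous.integrable_μT (by fun_prop)]
    push_cast
    refine Finset.sum_congr rfl fun ξ hξ => ?_
    rw [integral_finsetSum _ fun ξ _ => Continuous.integrable_μT (by fun_prop),
      Finset.sum_eq_single ξ]
    · rw [integral_const_mul, integral_eChar, sub_self, if_pos rfl, mul_one, Complex.star_def,
        Complex.mul_conj, Complex.normSq_eq_norm_sq]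
      push_cast; rfl
    · intro ζ _ hne
      rw [integral_const_mul, integral_eChar, if_neg (sub_ne_zero.2 hne.symm), mul_zero]
    · exact fun h => absurd hξ h
  rw [integral_complex_ofReal] at key
  exact_mod_cast key

lemma integral_norm_sq_trigSum_sub {τ : (Fin n → ℤ) → ℂ} {S : Finset (Fin n → ℤ)}
    (hS : ∀ ξ ∉ S, τ ξ = 0) (y : Fin n → ℝ) :
    ∫ x, ‖trigSum τ (x - y)‖ ^ 2 ∂μT n = ∑ ξ ∈ S, ‖τ ξ‖ ^ 2 := by
  simp_rw [trigSum_sub_right]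
  have h : ∀ ξ ∉ S, τ ξ * eChar (-y) ξ = 0 := fun ξ hξ => by rw [hS ξ hξ, zero_mul]
  simp_rw [trigSum_eq_sum h, integral_norm_sq_sum_eChar, norm_mul, norm_eChar, mul_one]

lemma trigSum_shift (τ : (Fin n → ℤ) → ℂ) (ζ : Fin n → ℤ) (x : Fin n → ℝ) :
    trigSum (fun ξ => τ (ξ + ζ)) x = eChar x (-ζ) * trigSum τ x := by
  have h := (Equiv.addRight ζ).tsum_eq fun ξ => eChar x (-ζ) * (τ ξ * eChar x ξ)
  rw [trigSum, trigSum, ← tsum_mul_left, ← h]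
  refine tsum_congr fun ξ => ?_
  rw [Equiv.coe_addRight, mul_left_comm, ← eChar_add_right, neg_add_cancel_comm_assoc]

lemma trigSum_dd {τ : (Fin n → ℤ) → ℂ} (hτ : τ.support.Finite) (l : Fin n) (x : Fin n → ℝ) :
    trigSum (dd l τ) x = (unitExp (-x l) - 1) * trigSum τ x := by
  have hs : ∀ ζ, Summable fun ξ => τ (ξ + ζ) * eChar x ξ := fun ζ =>
    summable_of_hasFiniteSupport <|
      (hτ.preimage (add_left_injective ζ).injOn).subset fun ξ hξ => left_ne_zero_of_mul hξ
  have h0 : Summable fun ξ => τ ξ * eChar x ξ := by simpa using hs 0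
  have e : eChar x (-Pi.single l 1) = unitExp (-x l) := by
    rw [← eChar_neg_left, eChar_single, Pi.neg_apply]
  rw [sub_mul, one_mul, ← e, ← trigSum_shift, trigSum, trigSum, trigSum, ← (hs _).tsum_sub h0]
  exact tsum_congr fun ξ => by rw [dd, sub_mul]

lemma dd_support_finite {τ : (Fin n → ℤ) → ℂ} (hτ : τ.support.Finite) (l : Fin n) :
    (dd l τ).support.Finite := by
  refine ((hτ.preimage (f := (· + Pi.single l 1)) (add_left_injective _).injOn).union hτ).subset
    fun ξ hξ => ?_
  by_contra h
  simp only [Set.mem_union, Set.mem_preimage, Function.mem_support, not_or, not_not] at h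
  exact hξ (by simp [dd, h.1, h.2])

lemma trigSum_dd_iterate {τ : (Fin n → ℤ) → ℂ} (hτ : τ.support.Finite) (l : Fin n) (m : ℕ)
    (x : Fin n → ℝ) : trigSum ((dd l)^[m] τ) x = (unitExp (-x l) - 1) ^ m * trigSum τ x := by
  induction m generalizing τ with
  | zero => simp
  | succ m ih =>
    rw [Function.iterate_succ_apply, ih (dd_support_finite hτ l), trigSum_dd hτ, pow_succ, mul_assoc]

lemma exists_integral_rpow_neg_le {s : ℝ} (hs : 1 / 2 < s) :
    ∃ C : ℝ, 0 < C ∧ ∀ r : ℝ, 0 < r → ∀ y : ℝ,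
      ∫ t in Set.Ico (0 : ℝ) 1, (r ^ 2 + ‖unitExp (t - y) - 1‖ ^ 2) ^ (-s)
        ≤ C * r ^ (1 - 2 * s) := by
  have hint : Integrable fun u : ℝ => (1 + u ^ 2) ^ (-s) := by
    have h := integrable_rpow_neg_one_add_norm_sq (E := ℝ) (μ := volume) (r := 2 * s)
      (by rw [Module.finrank_self]; push_cast; linarith)
    refine h.congr (Filter.Eventually.of_forall fun u => ?_)
    simp only [Real.norm_eq_abs, sq_abs]
    congr 1; ring
  set C₀ := ∫ u : ℝ, (1 + u ^ 2) ^ (-s)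
  refine ⟨C₀ + 1, add_pos_of_nonneg_of_pos (integral_nonneg fun u => by positivity) one_pos,
    fun r hr y => ?_⟩
  set F : ℝ → ℝ := fun t => (r ^ 2 + ‖unitExp t - 1‖ ^ 2) ^ (-s)
  have hF : Function.Periodic F 1 := fun t => by simp only [F, unitExp_periodic t]
  have hFc : Continuous F := by
    refine Continuous.rpow_const (by have := continuous_unitExp; fun_prop) fun t => Or.inl ?_
    positivity
  have hscale : ∀ t : ℝ, (r ^ 2 + t ^ 2) ^ (-s) = r ^ (-(2 * s)) * (1 + (r⁻¹ * t) ^ 2) ^ (-s) := by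
    intro t
    have h2 : r ^ (-(2 * s)) = (r ^ 2) ^ (-s) := by
      rw [← Real.rpow_natCast, ← Real.rpow_mul hr.le]; push_cast; ring_nf
    rw [h2, ← Real.mul_rpow (by positivity) (by positivity)]
    congr 1; field_simp
  have hint' : Integrable fun t : ℝ => (r ^ 2 + t ^ 2) ^ (-s) := by
    simp_rw [hscale]
    exact (hint.comp_mul_left' (inv_ne_zero hr.ne')).const_mul _
  calc ∫ t in Set.Ico (0 : ℝ) 1, F (t - y)
      = ∫ t in (0 : ℝ)..1, F (t - y) := by
        rw [integral_Ico_eq_integral_Ioc, ← intervalIntegral.integral_of_le zero_le_one]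
    _ = ∫ t in (-1 / 2 : ℝ)..(-1 / 2 + 1), F t := by
        rw [intervalIntegral.integral_comp_sub_right, ← hF.intervalIntegral_add_eq (0 - y)]
        congr 1; ring
    _ ≤ ∫ t in (-1 / 2 : ℝ)..(-1 / 2 + 1), (r ^ 2 + t ^ 2) ^ (-s) := by
        refine intervalIntegral.integral_mono_on (by norm_num) (hFc.intervalIntegrable _ _)
          hint'.intervalIntegrable fun t ht => ?_
        refine Real.rpow_le_rpow_of_nonpos (by positivity) ?_ (by linarith)
        have h := le_norm_unitExp_sub_one (t := t) (abs_le.2 ⟨by linarith [ht.1], by linarith [ht.2]⟩)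
        have := pow_le_pow_left₀ (abs_nonneg t) h 2
        rw [sq_abs] at this
        linarith
    _ ≤ ∫ t : ℝ, (r ^ 2 + t ^ 2) ^ (-s) := by
        rw [intervalIntegral.integral_of_le (by norm_num)]
        exact setIntegral_le_integral hint' (Filter.Eventually.of_forall fun t => by positivity)
    _ = r ^ (1 - 2 * s) * C₀ := by
        simp_rw [hscale]
        rw [integral_const_mul, Measure.integral_comp_mul_left (fun u : ℝ => (1 + u ^ 2) ^ (-s)),
          inv_inv, abs_of_pos hr, smul_eq_mul, ← mul_assoc, sub_eq_add_neg, add_comm,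
          Real.rpow_add hr, Real.rpow_one]
    _ ≤ (C₀ + 1) * r ^ (1 - 2 * s) := by
        rw [mul_comm]; gcongr; linarith

/-- Chordal distance `|e^{2πi(x_l - y_l)} - 1|` in the `l`-th coordinate. -/
def chord (x y : Fin n → ℝ) (l : Fin n) : ℝ := ‖unitExp (x l - y l) - 1‖

lemma chord_nonneg (x y : Fin n → ℝ) (l : Fin n) : 0 ≤ chord x y l := norm_nonneg _

lemma continuous_chord (y : Fin n → ℝ) (l : Fin n) : Continuous fun x => chord x y l := by
  have := continuous_unitExp
  unfold chord; fun_prop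

/-- The weight `r^{2k} + ∑_l |e^{2πi(x_l - y_l)} - 1|^{2k}`. -/
def chordWeight (k : ℕ) (r : ℝ) (y x : Fin n → ℝ) : ℝ :=
  r ^ (2 * k) + ∑ l, chord x y l ^ (2 * k)

lemma chordWeight_pos (k : ℕ) {r : ℝ} (hr : 0 < r) (y x : Fin n → ℝ) :
    0 < chordWeight k r y x :=
  add_pos_of_pos_of_nonneg (by positivity)
    (Finset.sum_nonneg fun l _ => pow_nonneg (chord_nonneg _ _ _) _)

lemma continuous_chordWeight (k : ℕ) (r : ℝ) (y : Fin n → ℝ) : Continuous (chordWeight k r y) := by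
  have := continuous_chord y
  unfold chordWeight; fun_prop

lemma exists_integral_inv_chordWeight_le (hn : 1 ≤ n) {k : ℕ} (hk : n < 2 * k) :
    ∃ C : ℝ, 0 < C ∧ ∀ r : ℝ, 0 < r → ∀ y : Fin n → ℝ,
      ∫ x, (chordWeight k r y x)⁻¹ ∂μT n ≤ C * r ^ ((n : ℝ) - 2 * k) := by
  have hn0 : (0 : ℝ) < n := by exact_mod_cast hn
  have hk' : (n : ℝ) < 2 * k := by exact_mod_cast hk
  set s : ℝ := k / n
  have hs : 1 / 2 < s := by rw [lt_div_iff₀ hn0]; linarith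
  obtain ⟨C, hC, h⟩ := exists_integral_rpow_neg_le hs
  refine ⟨2 ^ k * C ^ n, by positivity, fun r hr y => ?_⟩
  set G : (Fin n → ℝ) → ℝ := fun x => ∏ l, (r ^ 2 + chord x y l ^ 2) ^ (-s)
  have hGc : Continuous G := by
    refine continuous_finsetProd _ fun l _ => Continuous.rpow_const ?_ fun t => Or.inl ?_
    · have := continuous_chord y; fun_prop
    · positivity
  have hpt : ∀ x, (chordWeight k r y x)⁻¹ ≤ 2 ^ k * G x := by
    intro x
    have hv := chordWeight_pos k hr y x
    have h1 : ∀ l, (r ^ 2 + chord x y l ^ 2) ^ s ≤ (2 ^ k * chordWeight k r y x) ^ (1 / n : ℝ) := by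
      intro l
      have hsk : s = k * (1 / n : ℝ) := by simp [s, div_eq_mul_inv]
      rw [hsk, Real.rpow_mul (by positivity), Real.rpow_natCast]
      refine Real.rpow_le_rpow (by positivity) ?_ (by positivity)
      have hmax : r ^ 2 + chord x y l ^ 2 ≤ 2 * max (r ^ 2) (chord x y l ^ 2) := by
        linarith [le_max_left (r ^ 2) (chord x y l ^ 2), le_max_right (r ^ 2) (chord x y l ^ 2)]
      refine (pow_le_pow_left₀ (by positivity) hmax k).trans ?_
      rw [mul_pow]
      gcongr
      have hl := Finset.single_le_sum (f := fun l => chord x y l ^ (2 * k))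
        (fun l _ => pow_nonneg (chord_nonneg _ _ _) _) (Finset.mem_univ l)
      have hs0 : 0 ≤ ∑ l, chord x y l ^ (2 * k) :=
        Finset.sum_nonneg fun l _ => pow_nonneg (chord_nonneg _ _ _) _
      have hr0 : 0 ≤ r ^ (2 * k) := by positivity
      rcases max_cases (r ^ 2) (chord x y l ^ 2) with ⟨h, -⟩ | ⟨h, -⟩ <;>
        rw [h, ← pow_mul, chordWeight] <;> linarith
    have h2 : ∏ l, (r ^ 2 + chord x y l ^ 2) ^ s ≤ 2 ^ k * chordWeight k r y x := by
      refine (Finset.prod_le_prod (fun l _ => by positivity) fun l _ => h1 l).trans_eq ?_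
      rw [Finset.prod_const, Finset.card_univ, Fintype.card_fin, ← Real.rpow_mul_natCast
        (by positivity), one_div, inv_mul_cancel₀ hn0.ne', Real.rpow_one]
    have hG : G x = (∏ l, (r ^ 2 + chord x y l ^ 2) ^ s)⁻¹ := by
      rw [← Finset.prod_inv_distrib]
      exact Finset.prod_congr rfl fun l _ => Real.rpow_neg (by positivity) _
    have hp : 0 < ∏ l, (r ^ 2 + chord x y l ^ 2) ^ s :=
      Finset.prod_pos fun l _ => by positivity
    rw [hG, inv_le_comm₀ hv (by positivity), mul_inv, inv_inv, inv_mul_le_iff₀ (by positivity)]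
    exact h2
  calc ∫ x, (chordWeight k r y x)⁻¹ ∂μT n ≤ ∫ x, 2 ^ k * G x ∂μT n := by
        refine integral_mono (Continuous.integrable_μT ?_)
          (Continuous.integrable_μT (by fun_prop)) hpt
        exact (continuous_chordWeight k r y).inv₀ fun x => (chordWeight_pos k hr y x).ne'
    _ = 2 ^ k * ∏ l, ∫ t in Set.Ico (0 : ℝ) 1, (r ^ 2 + ‖unitExp (t - y l) - 1‖ ^ 2) ^ (-s) := by
        rw [integral_const_mul, μT_eq_pi, ← integral_fintype_prod_eq_prod]
        rfl
    _ ≤ 2 ^ k * ∏ l : Fin n, (C * r ^ (1 - 2 * s)) := by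
        gcongr with l
        exact h r hr (y l)
    _ = 2 ^ k * C ^ n * r ^ ((n : ℝ) - 2 * k) := by
        rw [Finset.prod_const, Finset.card_univ, Fintype.card_fin, mul_pow,
          ← Real.rpow_mul_natCast hr.le, mul_assoc]
        congr 3
        simp only [s]; field_simp

lemma dd_iterate_eq_zero {l : Fin n} {m : ℕ} {g : (Fin n → ℤ) → ℂ} {ξ : Fin n → ℤ}
    (h : ∀ i ≤ m, g (ξ + Pi.single l (i : ℤ)) = 0) : (dd l)^[m] g ξ = 0 := by
  induction m generalizing g with
  | zero => simpa using h 0 le_rfl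
  | succ m ih =>
    rw [Function.iterate_succ_apply]
    refine ih fun i hi => ?_
    have h1 := h (i + 1) (by lia)
    rw [Nat.cast_succ, Pi.single_add, ← add_assoc] at h1
    rw [dd, h1, h i (by lia), sub_zero]

/-- Symbols localized at frequency scale `R`, of size at most `B`, whose pure differences up to
order `k` gain the corresponding powers of `R`. -/
structure IsLocalizedSymbol (k : ℕ) (R B : ℝ) (τ : (Fin n → ℤ) → ℂ) : Prop where
  eq_zero : ∀ ξ, (∃ l, 2 * R < |(ξ l : ℝ)|) → τ ξ = 0
  norm_le : ∀ l, ∀ m ≤ k, ∀ ξ, ‖(dd l)^[m] τ ξ‖ ≤ B / R ^ m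

/-- The lattice points of sup norm at most `M`. -/
def latticeBox (n M : ℕ) : Finset (Fin n → ℤ) :=
  Fintype.piFinset fun _ => Finset.Icc (-(M : ℤ)) M

lemma mem_latticeBox {M : ℕ} {ξ : Fin n → ℤ} : ξ ∈ latticeBox n M ↔ ∀ l, |ξ l| ≤ M := by
  simp [latticeBox, Fintype.mem_piFinset, abs_le]

lemma exists_of_notMem_latticeBox {M : ℕ} {ξ : Fin n → ℤ} (h : ξ ∉ latticeBox n M) :
    ∃ l, (M : ℝ) + 1 ≤ |(ξ l : ℝ)| := by
  simp only [mem_latticeBox, not_forall, not_le] at h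
  obtain ⟨l, hl⟩ := h
  exact ⟨l, by exact_mod_cast (Int.add_one_le_iff.2 hl)⟩

lemma card_latticeBox (n M : ℕ) : (latticeBox n M).card = (2 * M + 1) ^ n := by
  rw [latticeBox, Fintype.card_piFinset_const, Int.card_Icc]
  congr 1; lia

lemma IsLocalizedSymbol.dd_iterate_eq_zero {k : ℕ} {R B : ℝ} {τ : (Fin n → ℤ) → ℂ}
    (hτ : IsLocalizedSymbol k R B τ) (l : Fin n) {m : ℕ} (hm : m ≤ k) {ξ : Fin n → ℤ}
    (hξ : ξ ∉ latticeBox n (⌊2 * R⌋₊ + k)) : (dd l)^[m] τ ξ = 0 := by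
  obtain ⟨j, hj⟩ := exists_of_notMem_latticeBox hξ
  refine _root_.dd_iterate_eq_zero fun i hi => hτ.eq_zero _ ⟨j, ?_⟩
  have h1 : |((Pi.single l (i : ℤ) : Fin n → ℤ) j : ℝ)| ≤ k := by
    by_cases h : j = l
    · subst h; simpa using hi.trans hm
    · simp [h]
  have h2 := Nat.lt_floor_add_one (2 * R)
  have h3 := abs_sub_abs_le_abs_add (ξ j : ℝ) ((Pi.single l (i : ℤ) : Fin n → ℤ) j : ℝ)
  push_cast [Pi.add_apply] at hj ⊢
  linarith

lemma IsLocalizedSymbol.apply_eq_zero {k : ℕ} {R B : ℝ} {τ : (Fin n → ℤ) → ℂ}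
    (hτ : IsLocalizedSymbol k R B τ) {ξ : Fin n → ℤ}
    (hξ : ξ ∉ latticeBox n (⌊2 * R⌋₊ + k)) : τ ξ = 0 := by
  obtain ⟨j, hj⟩ := exists_of_notMem_latticeBox hξ
  refine hτ.eq_zero _ ⟨j, ?_⟩
  have h2 := Nat.lt_floor_add_one (2 * R)
  push_cast at hj
  have : (0 : ℝ) ≤ k := by positivity
  linarith

lemma sum_latticeBox_norm_sq_le {k : ℕ} {R b : ℝ} (hR : 1 ≤ R) {f : (Fin n → ℤ) → ℂ}
    (hf : ∀ ξ, ‖f ξ‖ ≤ b) :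
    ∑ ξ ∈ latticeBox n (⌊2 * R⌋₊ + k), ‖f ξ‖ ^ 2 ≤ ((5 + 2 * k) * R) ^ n * b ^ 2 := by
  refine (Finset.sum_le_card_nsmul _ _ (b ^ 2) fun ξ _ =>
    pow_le_pow_left₀ (norm_nonneg _) (hf ξ) 2).trans ?_
  rw [nsmul_eq_mul, card_latticeBox]
  push_cast
  gcongr
  have := Nat.floor_le (show 0 ≤ 2 * R by linarith)
  nlinarith [show (0 : ℝ) ≤ k by positivity]

lemma le_add_inv_of_weight_le {K w V δ : ℝ} (hw : 0 < w) (hV : w ≤ 2 * V) (hδ : 0 < δ) :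
    K ≤ δ * (K ^ 2 * V) + δ⁻¹ * w⁻¹ := by
  have h1 : K ≤ δ * (K ^ 2 * (w / 2)) + δ⁻¹ * w⁻¹ := by
    have : δ * (K ^ 2 * (w / 2)) + δ⁻¹ * w⁻¹ - K
        = δ⁻¹ * w⁻¹ * (1 / 2 * (δ * w * K - 1) ^ 2 + 1 / 2) := by
      field_simp; ring
    have : 0 ≤ δ⁻¹ * w⁻¹ * (1 / 2 * (δ * w * K - 1) ^ 2 + 1 / 2) := by positivity
    linarith
  refine h1.trans ?_
  gcongr
  linarith

lemma integral_norm_sq_mul_chord_le {k : ℕ} {R B : ℝ} (hR : 1 ≤ R) {τ : (Fin n → ℤ) → ℂ}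
    (hτ : IsLocalizedSymbol k R B τ) (y : Fin n → ℝ) :
    ∫ x, ‖trigSum τ (x - y)‖ ^ 2 * ∑ l, chord x y l ^ (2 * k) ∂μT n
      ≤ n * (((5 + 2 * k) * R) ^ n * (B / R ^ k) ^ 2) := by
  have hfin : τ.support.Finite := (latticeBox n (⌊2 * R⌋₊ + k)).finite_toSet.subset
    fun ξ hξ => by by_contra h; exact hξ (hτ.apply_eq_zero h)
  have hc := continuous_trigSum (fun ξ => hτ.apply_eq_zero (ξ := ξ))
  have hcc := continuous_chord y
  simp_rw [Finset.mul_sum]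
  rw [integral_finsetSum _ fun l _ => Continuous.integrable_μT (by fun_prop)]
  have : ∀ l : Fin n, ∫ x, ‖trigSum τ (x - y)‖ ^ 2 * chord x y l ^ (2 * k) ∂μT n
      ≤ ((5 + 2 * k) * R) ^ n * (B / R ^ k) ^ 2 := fun l => by
    have h1 : ∀ x, ‖trigSum τ (x - y)‖ ^ 2 * chord x y l ^ (2 * k)
        = ‖trigSum ((dd l)^[k] τ) (x - y)‖ ^ 2 := fun x => by
      rw [trigSum_dd_iterate hfin, norm_mul, norm_pow, Pi.sub_apply, norm_unitExp_sub_one_neg,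
        chord]
      ring
    simp_rw [h1]
    rw [integral_norm_sq_trigSum_sub fun ξ hξ => hτ.dd_iterate_eq_zero l le_rfl hξ]
    exact sum_latticeBox_norm_sq_le hR fun ξ => hτ.norm_le l k le_rfl ξ
  refine (Finset.sum_le_sum fun l _ => this l).trans_eq ?_
  simp

lemma setLIntegral_trigSum_le {k : ℕ} {τ : (Fin n → ℤ) → ℂ} {y : Fin n → ℝ}
    {A : Set (Fin n → ℝ)} (hA : MeasurableSet A) (hc : Continuous (trigSum τ))
    {V : (Fin n → ℝ) → ℝ} (hV : Continuous V) {r δ P Q : ℝ} (hr : 0 < r) (hδ : 0 < δ)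
    (hAV : ∀ x ∈ A, chordWeight k r y x ≤ 2 * V x) (hV0 : ∀ x, 0 ≤ V x)
    (hP : ∫ x, ‖trigSum τ (x - y)‖ ^ 2 * V x ∂μT n ≤ P)
    (hQ : ∫ x, (chordWeight k r y x)⁻¹ ∂μT n ≤ Q) :
    ∫⁻ x in A, ‖trigSum τ (x - y)‖ₑ ∂μT n ≤ ENNReal.ofReal (δ * P + δ⁻¹ * Q) := by
  have hw : Continuous fun x => (chordWeight k r y x)⁻¹ :=
    (continuous_chordWeight k r y).inv₀ fun x => (chordWeight_pos k hr y x).ne'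
  have hcont : Continuous fun x => δ * (‖trigSum τ (x - y)‖ ^ 2 * V x)
      + δ⁻¹ * (chordWeight k r y x)⁻¹ := by fun_prop
  calc ∫⁻ x in A, ‖trigSum τ (x - y)‖ₑ ∂μT n
      ≤ ∫⁻ x in A, ENNReal.ofReal (δ * (‖trigSum τ (x - y)‖ ^ 2 * V x)
          + δ⁻¹ * (chordWeight k r y x)⁻¹) ∂μT n := by
        refine setLIntegral_mono' hA fun x hx => ?_
        rw [← ofReal_norm]
        exact ENNReal.ofReal_le_ofReal
          (le_add_inv_of_weight_le (chordWeight_pos k hr y x) (hAV x hx) hδ)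
    _ ≤ ∫⁻ x, ENNReal.ofReal (δ * (‖trigSum τ (x - y)‖ ^ 2 * V x)
          + δ⁻¹ * (chordWeight k r y x)⁻¹) ∂μT n := setLIntegral_le_lintegral _ _
    _ = ENNReal.ofReal (δ * ∫ x, ‖trigSum τ (x - y)‖ ^ 2 * V x ∂μT n
          + δ⁻¹ * ∫ x, (chordWeight k r y x)⁻¹ ∂μT n) := by
        rw [← ofReal_integral_eq_lintegral_ofReal hcont.integrable_μT,
          integral_add (Continuous.integrable_μT (by fun_prop))
            (Continuous.integrable_μT (by fun_prop)), integral_const_mul, integral_const_mul]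
        refine Filter.Eventually.of_forall fun x => ?_
        have := chordWeight_pos k hr y x
        have := hV0 x
        positivity
    _ ≤ _ := by
        refine ENNReal.ofReal_le_ofReal ?_
        gcongr

/-- `L¹` bounds for the kernel of a localized symbol: the total mass, and the mass at distance at
least `r` from the diagonal. -/
lemma exists_kernel_bound (hn : 1 ≤ n) {k : ℕ} (hk : n < 2 * k) :
    ∃ C : ℝ, 0 < C ∧ ∀ (R B : ℝ) (τ : (Fin n → ℤ) → ℂ), 1 ≤ R → 0 < B →
      IsLocalizedSymbol k R B τ → ∀ y : Fin n → ℝ,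
        ∫⁻ x, ‖trigSum τ (x - y)‖ₑ ∂μT n ≤ ENNReal.ofReal (C * B) ∧
        ∀ r : ℝ, 0 < r → ∫⁻ x in {x | ∃ l, r ≤ chord x y l}, ‖trigSum τ (x - y)‖ₑ ∂μT n
          ≤ ENNReal.ofReal (C * B * (r * R) ^ ((n : ℝ) / 2 - k)) := by
  obtain ⟨C₁, hC₁, hw⟩ := exists_integral_inv_chordWeight_le hn hk
  set D : ℝ := (5 + 2 * k) ^ n
  have hD : 0 < D := by positivity
  refine ⟨n * D + D + C₁, by positivity, fun R B τ hR hB hτ y => ?_⟩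
  have hR0 : 0 < R := by linarith
  have hc := continuous_trigSum (fun ξ => hτ.apply_eq_zero (ξ := ξ))
  have hcc := continuous_chord y
  have hsum : ∀ x, 0 ≤ ∑ l, chord x y l ^ (2 * k) := fun x =>
    Finset.sum_nonneg fun l _ => pow_nonneg (chord_nonneg _ _ _) _
  have hP := integral_norm_sq_mul_chord_le hR hτ y
  have hRpow : R ^ ((n : ℝ) - 2 * k) = R ^ n / (R ^ k) ^ 2 := by
    rw [Real.rpow_sub hR0, Real.rpow_natCast, ← pow_mul, mul_comm k 2]
    norm_cast
  have hP' : n * (((5 + 2 * k) * R) ^ n * (B / R ^ k) ^ 2)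
      = n * D * B ^ 2 * R ^ ((n : ℝ) - 2 * k) := by
    rw [hRpow, mul_pow, div_pow]; ring
  rw [hP'] at hP
  constructor
  · have h0 : ∫ x, ‖trigSum τ (x - y)‖ ^ 2 ∂μT n ≤ D * B ^ 2 * R ^ n := by
      rw [integral_norm_sq_trigSum_sub fun ξ => hτ.apply_eq_zero]
      refine (sum_latticeBox_norm_sq_le (b := B) hR fun ξ => ?_).trans_eq ?_
      · simpa using hτ.norm_le ⟨0, hn⟩ 0 (Nat.zero_le _) ξ
      · rw [mul_pow]; ring
    have hV : ∫ x, ‖trigSum τ (x - y)‖ ^ 2 * chordWeight k R⁻¹ y x ∂μT n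
        ≤ (n * D + D) * B ^ 2 * R ^ ((n : ℝ) - 2 * k) := by
      simp only [chordWeight, mul_add]
      rw [integral_add (Continuous.integrable_μT (by fun_prop))
        (Continuous.integrable_μT (by fun_prop)), integral_mul_const]
      have : (∫ x, ‖trigSum τ (x - y)‖ ^ 2 ∂μT n) * R⁻¹ ^ (2 * k)
          ≤ D * B ^ 2 * R ^ n * R⁻¹ ^ (2 * k) := by gcongr
      have e : D * B ^ 2 * R ^ n * R⁻¹ ^ (2 * k) = D * B ^ 2 * R ^ ((n : ℝ) - 2 * k) := by
        rw [hRpow, inv_pow, mul_comm 2 k, pow_mul]; field_simp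
      linarith
    have h := setLIntegral_trigSum_le (A := Set.univ) (k := k) (δ := B⁻¹ * (R⁻¹) ^ ((n : ℝ) - 2 * k))
      MeasurableSet.univ hc (continuous_chordWeight k R⁻¹ y) (inv_pos.2 hR0) (by positivity)
      (fun x _ => by have := chordWeight_pos k (inv_pos.2 hR0) y x; linarith)
      (fun x => (chordWeight_pos k (inv_pos.2 hR0) y x).le) hV (hw R⁻¹ (inv_pos.2 hR0) y)
    rw [Measure.restrict_univ] at h
    refine h.trans_eq ?_
    congr 1
    have hne : R ^ ((n : ℝ) - 2 * k) ≠ 0 := (Real.rpow_pos_of_pos hR0 _).ne'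
    rw [Real.inv_rpow hR0.le]
    field_simp
  · intro r hr
    have hmeas : MeasurableSet {x : Fin n → ℝ | ∃ l, r ≤ chord x y l} := by
      have : {x : Fin n → ℝ | ∃ l, r ≤ chord x y l} = ⋃ l, {x | r ≤ chord x y l} := by
        ext; simp
      rw [this]
      exact MeasurableSet.iUnion fun l => (isClosed_le continuous_const (hcc l)).measurableSet
    set e : ℝ := (n : ℝ) / 2 - k
    have he : (n : ℝ) - 2 * k = e + e := by simp only [e]; ring
    have h := setLIntegral_trigSum_le (k := k) (δ := B⁻¹ * (r ^ e / R ^ e)) (r := r)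
      hmeas hc (V := fun x => ∑ l, chord x y l ^ (2 * k)) (by fun_prop) hr (by positivity)
      (fun x ⟨l, hl⟩ => by
        have h1 : r ^ (2 * k) ≤ chord x y l ^ (2 * k) := pow_le_pow_left₀ hr.le hl _
        have h2 := Finset.single_le_sum (f := fun l => chord x y l ^ (2 * k))
          (fun l _ => pow_nonneg (chord_nonneg _ _ _) _) (Finset.mem_univ l)
        simp only [chordWeight] at h2 ⊢
        linarith) hsum hP (hw r hr y)
    refine h.trans (ENNReal.ofReal_le_ofReal ?_)
    have hr1 : 0 < r ^ e := Real.rpow_pos_of_pos hr _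
    have hR1 : 0 < R ^ e := Real.rpow_pos_of_pos hR0 _
    rw [he, Real.rpow_add hR0, Real.rpow_add hr, Real.mul_rpow hr.le hR0.le]
    have : B⁻¹ * (r ^ e / R ^ e) * (n * D * B ^ 2 * (R ^ e * R ^ e))
        + (B⁻¹ * (r ^ e / R ^ e))⁻¹ * (C₁ * (r ^ e * r ^ e))
        = (n * D + C₁) * (B * (r ^ e * R ^ e)) := by field_simp
    rw [this]
    have : 0 ≤ D * (B * (r ^ e * R ^ e)) := by positivity
    linarith

lemma hasDerivAt_fwdDiff_iterate (h : ℝ) (m : ℕ) {u u' : ℝ → ℝ} (hu : ∀ t, HasDerivAt u (u' t) t)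
    (t : ℝ) : HasDerivAt ((fwdDiff h)^[m] u) ((fwdDiff h)^[m] u' t) t := by
  induction m generalizing u u' with
  | zero => exact hu t
  | succ m ih =>
    exact ih fun s => ((hu (s + h)).comp_add_const s h).sub (hu s)

lemma exists_norm_fwdDiff_iterate_le (m : ℕ) {u : ℝ → ℝ} (hu : ContDiff ℝ (⊤ : ℕ∞) u)
    (hc : HasCompactSupport u) :
    ∃ C : ℝ, 0 ≤ C ∧ ∀ h : ℝ, 0 ≤ h → ∀ t, |(fwdDiff h)^[m] u t| ≤ C * h ^ m := by
  induction m generalizing u with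
  | zero =>
    obtain ⟨C, hC⟩ := hc.exists_bound_of_continuous hu.continuous
    exact ⟨C, (norm_nonneg _).trans (hC 0), fun h _ t => by simpa using hC t⟩
  | succ m ih =>
    obtain ⟨C, hC0, hC⟩ := ih ((contDiff_infty_iff_deriv.1 hu).2) hc.deriv
    refine ⟨C, hC0, fun h hh t => ?_⟩
    have hd := hasDerivAt_fwdDiff_iterate h m (u := u) (u' := deriv u)
      fun t => ((contDiff_infty_iff_deriv.1 hu).1 t).hasDerivAt
    have := Convex.norm_image_sub_le_of_norm_hasDerivWithin_le (f := (fwdDiff h)^[m] u)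
      (x := t) (y := t + h) (fun s _ => (hd s).hasDerivWithinAt) (fun s _ => hC h hh s)
      convex_univ (Set.mem_univ _) (Set.mem_univ _)
    rw [Function.iterate_succ_apply', fwdDiff]
    rw [add_sub_cancel_left, Real.norm_eq_abs, Real.norm_eq_abs, abs_of_nonneg hh] at this
    rwa [pow_succ, ← mul_assoc]

/-- A smooth even bump equal to `1` on `[-1,1]` and vanishing outside `(-2,2)`. -/
def stdBump : ContDiffBump (0 : ℝ) := ⟨1, 2, one_pos, one_lt_two⟩

/-- The smooth frequency cutoff to `|ξ|_∞ ≲ R`. -/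
def freqCutoff (R : ℝ) (ξ : Fin n → ℤ) : ℂ := ∏ j, (stdBump ((ξ j : ℝ) / R) : ℂ)

lemma stdBump_eq_one {t : ℝ} (ht : |t| ≤ 1) : stdBump t = 1 :=
  stdBump.one_of_mem_closedBall (by simpa [stdBump] using ht)

lemma stdBump_eq_zero {t : ℝ} (ht : 2 ≤ |t|) : stdBump t = 0 :=
  stdBump.zero_of_le_dist (by simpa [stdBump] using ht)

lemma norm_stdBump_le_one (t : ℝ) : ‖(stdBump t : ℂ)‖ ≤ 1 := by
  rw [Complex.norm_real, Real.norm_eq_abs, abs_of_nonneg stdBump.nonneg]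
  exact stdBump.le_one

lemma norm_freqCutoff_le_one (R : ℝ) (ξ : Fin n → ℤ) : ‖freqCutoff R ξ‖ ≤ 1 := by
  rw [freqCutoff, norm_prod]
  exact Finset.prod_le_one (fun _ _ => norm_nonneg _) fun _ _ => norm_stdBump_le_one _

lemma freqCutoff_eq_zero {R : ℝ} (hR : 0 < R) {ξ : Fin n → ℤ} (h : ∃ l, 2 * R ≤ |(ξ l : ℝ)|) :
    freqCutoff R ξ = 0 := by
  obtain ⟨l, hl⟩ := h
  refine Finset.prod_eq_zero (Finset.mem_univ l) ?_
  rw [stdBump_eq_zero, Complex.ofReal_zero]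
  rwa [abs_div, abs_of_pos hR, le_div_iff₀ hR]

lemma freqCutoff_eq_one {R : ℝ} (hR : 0 < R) {ξ : Fin n → ℤ} (h : ∀ l, |(ξ l : ℝ)| ≤ R) :
    freqCutoff R ξ = 1 := by
  refine Finset.prod_eq_one fun l _ => ?_
  rw [stdBump_eq_one, Complex.ofReal_one]
  rw [abs_div, abs_of_pos hR, div_le_one hR]
  exact h l

lemma dd_iterate_mul_prod (R : ℝ) (l : Fin n) (m : ℕ) (u : ℝ → ℝ) (ξ : Fin n → ℤ) :
    (dd l)^[m] (fun ξ => (u ((ξ l : ℝ) / R) : ℂ)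
        * ∏ j ∈ Finset.univ.erase l, (stdBump ((ξ j : ℝ) / R) : ℂ)) ξ
      = (((fwdDiff R⁻¹)^[m] u ((ξ l : ℝ) / R) : ℝ) : ℂ)
        * ∏ j ∈ Finset.univ.erase l, (stdBump ((ξ j : ℝ) / R) : ℂ) := by
  induction m generalizing u with
  | zero => rfl
  | succ m ih =>
    rw [Function.iterate_succ_apply, Function.iterate_succ_apply, ← ih]
    refine congrFun (congrArg _ (funext fun ζ => ?_)) ξ
    have hp : ∏ j ∈ Finset.univ.erase l, (stdBump (((ζ + Pi.single l 1 : Fin n → ℤ) j : ℝ) / R) : ℂ)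
        = ∏ j ∈ Finset.univ.erase l, (stdBump ((ζ j : ℝ) / R) : ℂ) :=
      Finset.prod_congr rfl fun j hj => by
        rw [Pi.add_apply, Pi.single_eq_of_ne (Finset.ne_of_mem_erase hj), add_zero]
    simp only [dd, fwdDiff]
    rw [hp, ← sub_mul]
    simp [add_div]

lemma exists_norm_dd_iterate_freqCutoff_le (k : ℕ) :
    ∃ C : ℝ, 0 < C ∧ ∀ R : ℝ, 0 < R → ∀ l : Fin n, ∀ m ≤ k, ∀ ξ : Fin n → ℤ,
      ‖(dd l)^[m] (freqCutoff R) ξ‖ ≤ C / R ^ m := by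
  choose c hc0 hc using fun m =>
    exists_norm_fwdDiff_iterate_le m stdBump.contDiff stdBump.hasCompactSupport
  refine ⟨1 + ∑ m ∈ Finset.range (k + 1), c m, add_pos_of_pos_of_nonneg one_pos
    (Finset.sum_nonneg fun m _ => hc0 m), fun R hR l m hm ξ => ?_⟩
  have e : (freqCutoff R : (Fin n → ℤ) → ℂ) = fun ξ => (stdBump ((ξ l : ℝ) / R) : ℂ)
        * ∏ j ∈ Finset.univ.erase l, (stdBump ((ξ j : ℝ) / R) : ℂ) := by
    funext ξ
    rw [freqCutoff, Finset.mul_prod_erase _ (fun j => (stdBump ((ξ j : ℝ) / R) : ℂ))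
      (Finset.mem_univ l)]
  rw [e, dd_iterate_mul_prod, norm_mul, norm_prod, Complex.norm_real, Real.norm_eq_abs]
  have h1 := hc m R⁻¹ (by positivity) ((ξ l : ℝ) / R)
  have h2 : ∏ j ∈ Finset.univ.erase l, ‖(stdBump ((ξ j : ℝ) / R) : ℂ)‖ ≤ 1 :=
    Finset.prod_le_one (fun _ _ => norm_nonneg _) fun _ _ => norm_stdBump_le_one _
  have h3 : c m ≤ 1 + ∑ m ∈ Finset.range (k + 1), c m := by
    have := Finset.single_le_sum (f := c) (fun m _ => hc0 m) (Finset.mem_range.2 (Nat.lt_succ_of_le hm))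
    linarith
  calc _ ≤ c m * R⁻¹ ^ m * 1 := mul_le_mul h1 h2 (Finset.prod_nonneg fun _ _ => norm_nonneg _)
        (by have := hc0 m; positivity)
    _ = c m / R ^ m := by rw [mul_one, inv_pow, div_eq_mul_inv]
    _ ≤ _ := by gcongr

lemma dd_iterate_sub (l : Fin n) (m : ℕ) (f g : (Fin n → ℤ) → ℂ) (ξ : Fin n → ℤ) :
    (dd l)^[m] (fun ξ => f ξ - g ξ) ξ = (dd l)^[m] f ξ - (dd l)^[m] g ξ := by
  induction m generalizing f g with
  | zero => rfl
  | succ m ih =>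
    simp only [Function.iterate_succ_apply]
    have e : dd l (fun ξ => f ξ - g ξ) = fun ξ => dd l f ξ - dd l g ξ := by
      funext ζ; simp only [dd]; ring
    rw [e, ih]

lemma dd_iterate_add (l : Fin n) (m : ℕ) (f g : (Fin n → ℤ) → ℂ) (ξ : Fin n → ℤ) :
    (dd l)^[m] (fun ξ => f ξ + g ξ) ξ = (dd l)^[m] f ξ + (dd l)^[m] g ξ := by
  induction m generalizing f g with
  | zero => rfl
  | succ m ih =>
    simp only [Function.iterate_succ_apply]
    have e : dd l (fun ξ => f ξ + g ξ) = fun ξ => dd l f ξ + dd l g ξ := by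
      funext ζ; simp only [dd]; ring
    rw [e, ih]

lemma dd_iterate_shift (l : Fin n) (m : ℕ) (f : (Fin n → ℤ) → ℂ) (ζ ξ : Fin n → ℤ) :
    (dd l)^[m] (fun ξ => f (ξ + ζ)) ξ = (dd l)^[m] f (ξ + ζ) := by
  induction m generalizing f with
  | zero => rfl
  | succ m ih =>
    simp only [Function.iterate_succ_apply]
    have e : dd l (fun ξ => f (ξ + ζ)) = fun ξ => dd l f (ξ + ζ) := by
      funext ζ; simp only [dd]; rw [add_right_comm]
    rw [e, ih]

/-- Leibniz rule for iterated differences, in quantitative form along one coordinate line. -/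
lemma norm_dd_iterate_mul_le (l : Fin n) (ξ : Fin n → ℤ) {ρ : ℝ} (m k : ℕ) (hm : m ≤ k)
    {f g : (Fin n → ℤ) → ℂ} {A B : ℝ}
    (hf : ∀ i i' : ℕ, i + i' ≤ k → ‖(dd l)^[i] f (ξ + Pi.single l (i' : ℤ))‖ ≤ A * ρ ^ i)
    (hg : ∀ i i' : ℕ, i + i' ≤ k → ‖(dd l)^[i] g (ξ + Pi.single l (i' : ℤ))‖ ≤ B * ρ ^ i) :
    ‖(dd l)^[m] (fun ξ => f ξ * g ξ) ξ‖ ≤ 2 ^ m * (A * B) * ρ ^ m := by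
  induction m generalizing k f g A B with
  | zero =>
    have h1 := hf 0 0 (by simp)
    have h2 := hg 0 0 (by simp)
    simp only [Function.iterate_zero, id, Nat.cast_zero, Pi.single_zero, add_zero, pow_zero,
      mul_one] at h1 h2
    simpa using mul_le_mul h1 h2 (norm_nonneg _) ((norm_nonneg _).trans h1)
  | succ m ih =>
    have e : dd l (fun ξ => f ξ * g ξ)
        = fun ξ => dd l f ξ * g (ξ + Pi.single l 1) + f ξ * dd l g ξ := by
      funext ζ; simp only [dd]; ring
    rw [Function.iterate_succ_apply, e, dd_iterate_add]
    have h1 := ih (k - 1) (by lia) (f := dd l f) (g := fun ξ => g (ξ + Pi.single l 1))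
      (A := A * ρ) (B := B)
      (fun i i' hi => by
        have := hf (i + 1) i' (by lia)
        rw [Function.iterate_succ_apply] at this
        refine this.trans_eq (by ring))
      (fun i i' hi => by
        have := hg i (i' + 1) (by lia)
        rw [dd_iterate_shift, add_assoc, ← Pi.single_add]
        exact_mod_cast this)
    have h2 := ih (k - 1) (by lia) (f := f) (g := dd l g) (A := A) (B := B * ρ)
      (fun i i' hi => hf i i' (by lia))
      (fun i i' hi => by
        have := hg (i + 1) i' (by lia)
        rw [Function.iterate_succ_apply] at this
        refine this.trans_eq (by ring))
    refine (norm_add_le _ _).trans ((add_le_add h1 h2).trans_eq ?_)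
    ring

lemma one_le_jb (ξ : Fin n → ℤ) : 1 ≤ jb ξ := by
  rw [jb, Real.one_le_sqrt]
  have : 0 ≤ ∑ j, (ξ j : ℝ) ^ 2 := Finset.sum_nonneg fun j _ => sq_nonneg _
  linarith

lemma abs_le_jb (ξ : Fin n → ℤ) (l : Fin n) : |(ξ l : ℝ)| ≤ jb ξ := by
  refine Real.abs_le_sqrt ?_
  have := Finset.single_le_sum (f := fun j => (ξ j : ℝ) ^ 2) (fun j _ => sq_nonneg _)
    (Finset.mem_univ l)
  linarith

/-- The dyadic pieces of frequency space. -/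
def freqPiece : ℕ → (Fin n → ℤ) → ℂ
  | 0 => freqCutoff 1
  | j + 1 => fun ξ => freqCutoff (2 ^ (j + 1)) ξ - freqCutoff (2 ^ j) ξ

lemma sum_freqPiece (J : ℕ) (ξ : Fin n → ℤ) :
    ∑ j ∈ Finset.range (J + 1), freqPiece j ξ = freqCutoff (2 ^ J) ξ := by
  induction J with
  | zero => simp [freqPiece]
  | succ J ih => rw [Finset.sum_range_succ, ih, freqPiece]; ring

lemma freqPiece_eq_zero {j : ℕ} {ξ : Fin n → ℤ} (h : ∃ l, 2 * (2 : ℝ) ^ j < |(ξ l : ℝ)|) :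
    freqPiece j ξ = 0 := by
  obtain ⟨l, hl⟩ := h
  cases j with
  | zero => exact freqCutoff_eq_zero one_pos ⟨l, by simpa using hl.le⟩
  | succ j =>
    have : (0 : ℝ) < 2 ^ j := by positivity
    change freqCutoff (2 ^ (j + 1)) ξ - freqCutoff (2 ^ j) ξ = 0
    rw [freqCutoff_eq_zero (by positivity) ⟨l, hl.le⟩,
      freqCutoff_eq_zero (by positivity) ⟨l, ?_⟩, sub_zero]
    rw [pow_succ] at hl
    linarith

lemma half_le_jb_of_freqPiece_ne_zero {j : ℕ} {ξ : Fin n → ℤ} (h : freqPiece j ξ ≠ 0) :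
    (2 : ℝ) ^ j / 2 ≤ 1 ∨ ∃ l, (2 : ℝ) ^ j / 2 ≤ |(ξ l : ℝ)| := by
  cases j with
  | zero => left; norm_num
  | succ j =>
    right
    by_contra! hc
    apply h
    have h2 : (2 : ℝ) ^ (j + 1) / 2 = 2 ^ j := by rw [pow_succ]; ring
    have hp : (0 : ℝ) < 2 ^ j := by positivity
    change freqCutoff (2 ^ (j + 1)) ξ - freqCutoff (2 ^ j) ξ = 0
    rw [freqCutoff_eq_one (by positivity), freqCutoff_eq_one (by positivity), sub_self]
    · intro l; have := hc l; linarith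
    · intro l; have := hc l; rw [pow_succ]; linarith

lemma exists_norm_dd_iterate_freqPiece_le (k : ℕ) :
    ∃ C : ℝ, 0 < C ∧ ∀ j : ℕ, ∀ l : Fin n, ∀ m ≤ k, ∀ ξ : Fin n → ℤ,
      ‖(dd l)^[m] (freqPiece j) ξ‖ ≤ C / (2 ^ j) ^ m := by
  obtain ⟨C, hC, h⟩ := exists_norm_dd_iterate_freqCutoff_le (n := n) k
  refine ⟨C + C * 2 ^ k, by positivity, fun j l m hm ξ => ?_⟩
  cases j with
  | zero =>
    refine (h 1 one_pos l m hm ξ).trans ?_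
    rw [pow_zero]; gcongr
    have : 0 < C * 2 ^ k := by positivity
    linarith
  | succ j =>
    have h1 := h (2 ^ (j + 1)) (by positivity) l m hm ξ
    have h2 := h (2 ^ j) (by positivity) l m hm ξ
    have e : C / (2 ^ j) ^ m = C * 2 ^ m / (2 ^ (j + 1)) ^ m := by
      rw [pow_succ, mul_pow]; field_simp
    have h3 : C * 2 ^ m / (2 ^ (j + 1)) ^ m ≤ C * 2 ^ k / (2 ^ (j + 1)) ^ m := by
      gcongr; norm_num
    have e' : (freqPiece (j + 1) : (Fin n → ℤ) → ℂ)
      = fun ξ => freqCutoff (2 ^ (j + 1)) ξ - freqCutoff (2 ^ j) ξ := rfl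
    rw [e', dd_iterate_sub, add_div]
    exact (norm_sub_le _ _).trans (by linarith)

/-- Dyadic localization of a Mikhlin symbol. -/
lemma exists_isLocalizedSymbol_mul_freqPiece {k : ℕ} {σ : (Fin n → ℤ) → ℂ} {A : ℝ} (hA : 0 < A)
    (hσ : ∀ l, ∀ m ≤ k, ∀ ξ, ‖(dd l)^[m] σ ξ‖ ≤ A / jb ξ ^ m) :
    ∃ B : ℝ, 0 < B ∧ ∀ j, IsLocalizedSymbol k (2 ^ j) B fun ξ => σ ξ * freqPiece j ξ := by
  obtain ⟨C, hC, h⟩ := exists_norm_dd_iterate_freqPiece_le (n := n) k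
  set c : ℝ := 2 * (k + 1)
  have hc1 : 1 ≤ c := by simp only [c]; linarith [show (0 : ℝ) ≤ k by positivity]
  refine ⟨(2 * c) ^ k * (A * C), by positivity, fun j => ⟨fun ξ hξ => by
    rw [freqPiece_eq_zero hξ, mul_zero], fun l m hm ξ => ?_⟩⟩
  set R : ℝ := 2 ^ j
  have hR : 0 < R := by positivity
  by_cases hz : ∀ i ≤ m, freqPiece j (ξ + Pi.single l (i : ℤ)) = 0
  · rw [dd_iterate_eq_zero fun i hi => by rw [hz i hi, mul_zero], norm_zero]; positivity
  push Not at hz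
  obtain ⟨i₀, hi₀, hne⟩ := hz
  have hjb : ∀ i' ≤ k, R ≤ c * jb (ξ + Pi.single l (i' : ℤ)) := fun i' hi' => by
    have h1 := one_le_jb (ξ + Pi.single l (i' : ℤ))
    have hk0 : (0 : ℝ) ≤ k := by positivity
    have h3 : R / 2 - k ≤ jb (ξ + Pi.single l (i' : ℤ)) := by
      rcases half_le_jb_of_freqPiece_ne_zero hne with h | ⟨l', h⟩
      · linarith
      · have h4 := abs_le_jb (ξ + Pi.single l (i' : ℤ)) l'
        by_cases hl : l' = l
        · subst hl
          simp only [Pi.add_apply, Pi.single_eq_same, Int.cast_add, Int.cast_natCast] at h h4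
          have hi0 : (0 : ℝ) ≤ i₀ := by positivity
          have hi0' : (0 : ℝ) ≤ i' := by positivity
          have a1 : (i₀ : ℝ) ≤ k := by exact_mod_cast hi₀.trans hm
          have a2 : (i' : ℝ) ≤ k := by exact_mod_cast hi'
          have a3 : |(ξ l' + i₀ : ℝ)| ≤ |(ξ l' + i' : ℝ)| + k := by
            rw [← sub_le_iff_le_add']
            refine (abs_sub_abs_le_abs_sub _ _).trans (abs_le.2 ⟨by linarith, by linarith⟩)
          linarith
        · simp only [Pi.add_apply, Pi.single_eq_of_ne hl, add_zero] at h h4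
          linarith
    simp only [c]
    nlinarith
  have hb := norm_dd_iterate_mul_le l ξ (ρ := c / R) m k hm (f := σ) (g := freqPiece j) (A := A)
    (B := C)
    (fun i i' hi => (hσ l i (by lia) _).trans (by
      have := hjb i' (by lia)
      have h0 := one_le_jb (ξ + Pi.single l (i' : ℤ))
      rw [div_eq_mul_inv, ← inv_pow]
      gcongr
      rw [inv_eq_one_div, div_le_div_iff₀ (by linarith) hR]
      linarith))
    (fun i i' hi => (h j l i (by lia) _).trans (by
      rw [div_eq_mul_inv, ← inv_pow, inv_eq_one_div]
      gcongr))
  refine hb.trans ?_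
  rw [div_pow, ← mul_div_assoc]
  refine div_le_div_of_nonneg_right ?_ (by positivity)
  clear_value c
  calc 2 ^ m * (A * C) * c ^ m = (2 * c) ^ m * (A * C) := by rw [mul_pow]; ring
    _ ≤ (2 * c) ^ k * (A * C) := by
      gcongr
      linarith

lemma dd_iterate_eChar_sub_one (u : Fin n → ℝ) (l : Fin n) (m : ℕ) (ξ : Fin n → ℤ) :
    (dd l)^[m + 1] (fun ξ => eChar u ξ - 1) ξ = (unitExp (u l) - 1) ^ (m + 1) * eChar u ξ := by
  have h : ∀ (a : ℂ), dd l (fun ξ => a * eChar u ξ)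
      = fun ξ => ((unitExp (u l) - 1) * a) * eChar u ξ := fun a => by
    funext ζ
    rw [dd, eChar_add_right, eChar_single]; ring
  have h' : ∀ (a : ℂ) (m : ℕ), (dd l)^[m] (fun ξ => a * eChar u ξ)
      = fun ξ => ((unitExp (u l) - 1) ^ m * a) * eChar u ξ := fun a m => by
    induction m with
    | zero => simp
    | succ m ih => rw [Function.iterate_succ_apply', ih, h]; funext ζ; ring
  have h1 : dd l (fun ξ => eChar u ξ - 1) = fun ξ => (unitExp (u l) - 1) * eChar u ξ := by
    funext ζ
    rw [dd, eChar_add_right, eChar_single]; ring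
  rw [Function.iterate_succ_apply, h1, h', pow_succ]

lemma norm_eChar_sub_one_le {u : Fin n → ℝ} {h M : ℝ} (hu : ∀ l, |u l| ≤ h) {ξ : Fin n → ℤ}
    (hξ : ∀ l, |(ξ l : ℝ)| ≤ M) : ‖eChar u ξ - 1‖ ≤ 2 * π * (n * (h * M)) := by
  rw [eChar_eq_unitExp]
  refine (norm_unitExp_sub_one_le _).trans ?_
  gcongr
  refine (Finset.abs_sum_le_sum_abs _ _).trans ?_
  refine (Finset.sum_le_card_nsmul _ _ (h * M) fun l _ => ?_).trans_eq (by simp)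
  rw [abs_mul]
  exact mul_le_mul (hu l) (hξ l) (abs_nonneg _) ((abs_nonneg _).trans (hu l))

/-- A small translation gains a factor `hR`. -/
lemma IsLocalizedSymbol.mul_eChar_sub_one {k : ℕ} {R B : ℝ} {τ : (Fin n → ℤ) → ℂ} (hR : 1 ≤ R)
    (hB : 0 < B) (hτ : IsLocalizedSymbol k R B τ) {u : Fin n → ℝ} {h : ℝ} (hh : 0 < h)
    (hhR : h * R ≤ 1) (hu : ∀ l, |u l| ≤ h) :
    IsLocalizedSymbol k R (((4 * π) ^ k * (2 * π * n * (2 + k) + 1)) * B * (h * R))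
      fun ξ => τ ξ * (eChar u ξ - 1) := by
  have hR0 : 0 < R := by linarith
  have hpi := Real.pi_gt_three
  refine ⟨fun ξ hξ => by rw [hτ.eq_zero ξ hξ, zero_mul], fun l m hm ξ => ?_⟩
  by_cases hz : ∀ i ≤ m, τ (ξ + Pi.single l (i : ℤ)) = 0
  · rw [_root_.dd_iterate_eq_zero fun i hi => by rw [hz i hi, zero_mul], norm_zero]; positivity
  push Not at hz
  obtain ⟨i₀, hi₀, hne⟩ := hz
  have hbd : ∀ i' ≤ k, ∀ l', |((ξ + Pi.single l (i' : ℤ) : Fin n → ℤ) l' : ℝ)| ≤ 2 * R + k := by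
    intro i' hi' l'
    have h0 : |((ξ + Pi.single l (i₀ : ℤ) : Fin n → ℤ) l' : ℝ)| ≤ 2 * R := by
      by_contra! hc
      exact hne (hτ.eq_zero _ ⟨l', hc⟩)
    have hk0 : (0 : ℝ) ≤ k := by positivity
    by_cases hl : l' = l
    · subst hl
      simp only [Pi.add_apply, Pi.single_eq_same, Int.cast_add, Int.cast_natCast] at h0 ⊢
      have hi0 : (0 : ℝ) ≤ i₀ := by positivity
      have hi0' : (0 : ℝ) ≤ i' := by positivity
      have a1 : (i₀ : ℝ) ≤ k := by exact_mod_cast hi₀.trans hm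
      have a2 : (i' : ℝ) ≤ k := by exact_mod_cast hi'
      rw [abs_le] at h0 ⊢
      constructor <;> linarith [h0.1, h0.2]
    · simp only [Pi.add_apply, Pi.single_eq_of_ne hl, add_zero] at h0 ⊢
      linarith
  have hb := norm_dd_iterate_mul_le l ξ (ρ := 2 * π / R) m k hm (f := τ)
    (g := fun ξ => eChar u ξ - 1) (A := B) (B := (2 * π * n * (2 + k) + 1) * (h * R))
    (fun i i' hi => (hτ.norm_le l i (by lia) _).trans (by
      rw [div_eq_mul_inv, ← inv_pow, inv_eq_one_div]
      gcongr
      linarith))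
    (fun i i' hi => by
      cases i with
      | zero =>
        refine (norm_eChar_sub_one_le hu (hbd i' (by lia))).trans ?_
        rw [pow_zero, mul_one]
        have h1 : 2 * R + k ≤ (2 + k) * R := by
          have hk0 : (0 : ℝ) ≤ k := by positivity
          nlinarith
        calc 2 * π * (n * (h * (2 * R + k))) ≤ 2 * π * (n * (h * ((2 + k) * R))) := by gcongr
          _ = (2 * π * n * (2 + k)) * (h * R) := by ring
          _ ≤ _ := by gcongr; linarith
      | succ i =>
        rw [dd_iterate_eChar_sub_one, norm_mul, norm_eChar, mul_one, norm_pow]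
        have h1 : ‖unitExp (u l) - 1‖ ≤ 2 * π * h :=
          (norm_unitExp_sub_one_le _).trans (by gcongr; exact hu l)
        have h2 : h ≤ 1 / R := by rwa [le_div_iff₀ hR0]
        calc ‖unitExp (u l) - 1‖ ^ (i + 1) ≤ (2 * π * h) ^ (i + 1) := by gcongr
          _ = 1 * (2 * π) ^ (i + 1) * h * h ^ i := by rw [mul_pow]; ring
          _ ≤ (2 * π * n * (2 + k) + 1) * (2 * π) ^ (i + 1) * h * (1 / R) ^ i := by
            gcongr
            have : 0 ≤ 2 * π * n * (2 + k) := by positivity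
            linarith
          _ = _ := by
            rw [div_pow, div_pow, one_pow, pow_succ R]; field_simp)
  refine hb.trans ?_
  rw [div_pow, ← mul_div_assoc]
  refine div_le_div_of_nonneg_right ?_ (by positivity)
  calc 2 ^ m * (B * ((2 * π * n * (2 + k) + 1) * (h * R))) * (2 * π) ^ m
      = (4 * π) ^ m * (2 * π * n * (2 + k) + 1) * B * (h * R) := by
        rw [show 4 * π = 2 * (2 * π) by ring, mul_pow 2 (2 * π)]; ring
    _ ≤ _ := by
      gcongr
      linarith

lemma mIdxList_single (l : Fin n) (m : ℕ) : mIdxList (Pi.single l m) = List.replicate m l := by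
  have key : ∀ L : List (Fin n), L.Nodup →
      (L.flatMap fun j => List.replicate ((Pi.single l m : Fin n → ℕ) j) j)
        = if l ∈ L then List.replicate m l else [] := by
    intro L hL
    induction L with
    | nil => simp
    | cons a L ih =>
      rw [List.nodup_cons] at hL
      rw [List.flatMap_cons, ih hL.2]
      by_cases ha : a = l
      · subst ha
        simp [hL.1]
      · simp [Ne.symm ha]
  rw [mIdxList, key _ (List.nodup_finRange n), if_pos (List.mem_finRange l)]

lemma ddM_single (l : Fin n) (m : ℕ) (σ : (Fin n → ℤ) → ℂ) :
    ddM (Pi.single l m) σ = (dd l)^[m] σ := by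
  rw [ddM, mIdxList_single]
  induction m with
  | zero => rfl
  | succ m ih => rw [List.replicate_succ, List.foldr_cons, ih, Function.iterate_succ_apply']

lemma exists_uniform_symbol_bound {k : ℕ} {σ : (Fin n → ℤ) → ℂ}
    (hσ : ∀ α : Fin n → ℕ, (∑ j, α j) ≤ k →
      ∃ C : ℝ, 0 < C ∧ ∀ ξ : Fin n → ℤ, ‖ddM α σ ξ‖ ≤ C * jb ξ ^ (-(∑ j, (α j : ℝ)))) :
    ∃ A : ℝ, 0 < A ∧ (∀ ξ, ‖σ ξ‖ ≤ A) ∧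
      ∀ l, ∀ m ≤ k, ∀ ξ, ‖(dd l)^[m] σ ξ‖ ≤ A / jb ξ ^ m := by
  have h : ∀ l, ∀ m, ∃ C : ℝ, 0 < C ∧ (m ≤ k → ∀ ξ, ‖(dd l)^[m] σ ξ‖ ≤ C / jb ξ ^ m) := by
    intro l m
    by_cases hm : m ≤ k
    · obtain ⟨C, hC, h⟩ := hσ (Pi.single l m) (by simpa using hm)
      refine ⟨C, hC, fun _ ξ => ?_⟩
      have := h ξ
      have e : ∑ j, (((Pi.single l m : Fin n → ℕ) j : ℕ) : ℝ) = m := by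
        rw [← Nat.cast_sum]; simp
      rwa [ddM_single, e, Real.rpow_neg (zero_le_one.trans (one_le_jb ξ)), Real.rpow_natCast,
        ← div_eq_mul_inv] at this
    · exact ⟨1, one_pos, fun h => absurd h hm⟩
  choose C hC h using h
  obtain ⟨D, hD, h0⟩ := hσ 0 (by simp)
  have hsum : 0 ≤ ∑ l, ∑ m ∈ Finset.range (k + 1), C l m :=
    Finset.sum_nonneg fun l _ => Finset.sum_nonneg fun m _ => (hC l m).le
  refine ⟨D + ∑ l, ∑ m ∈ Finset.range (k + 1), C l m, by positivity, fun ξ => ?_,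
    fun l m hm ξ => (h l m hm ξ).trans ?_⟩
  · have e : mIdxList (0 : Fin n → ℕ) = [] := by simp [mIdxList]
    have := h0 ξ
    simp only [ddM, e, List.foldr_nil, Pi.zero_apply, Nat.cast_zero, Finset.sum_const_zero,
      neg_zero, Real.rpow_zero, mul_one] at this
    linarith
  · have h1 : C l m ≤ ∑ m ∈ Finset.range (k + 1), C l m :=
      Finset.single_le_sum (fun m _ => (hC l m).le) (Finset.mem_range.2 (Nat.lt_succ_of_le hm))
    have h2 : ∑ m ∈ Finset.range (k + 1), C l m ≤ ∑ l, ∑ m ∈ Finset.range (k + 1), C l m :=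
      Finset.single_le_sum (f := fun l => ∑ m ∈ Finset.range (k + 1), C l m)
        (fun l _ => Finset.sum_nonneg fun m _ => (hC l m).le) (Finset.mem_univ l)
    exact div_le_div_of_nonneg_right (by linarith) (pow_nonneg (zero_le_one.trans (one_le_jb ξ)) _)

/-- The index of the dyadic cell of side `2^{-i}` containing `x`. -/
def cellIdx (i : ℕ) (x : Fin n → ℝ) : Fin n → ℤ := fun l => ⌊(2 : ℝ) ^ i * x l⌋

/-- The dyadic cell of side `2^{-i}` with index `κ`. -/
def cell (i : ℕ) (κ : Fin n → ℤ) : Set (Fin n → ℝ) := {x | cellIdx i x = κ}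

/-- The indices of the dyadic cells making up the fundamental domain. -/
def cellBox (n i : ℕ) : Finset (Fin n → ℤ) := Fintype.piFinset fun _ => Finset.Ico 0 (2 ^ i)

/-- The average of `u` over the dyadic cell of side `2^{-i}` containing `x`. -/
def cellAvg {𝕜 : Type*} [RCLike 𝕜] (i : ℕ) (u : (Fin n → ℝ) → 𝕜) (x : Fin n → ℝ) : 𝕜 :=
  ((2 : 𝕜) ^ i) ^ n * ∫ y in cell i (cellIdx i x), u y ∂μT n

lemma measurable_cellIdx (i : ℕ) : Measurable (cellIdx (n := n) i) :=
  measurable_pi_lambda _ fun l => Int.measurable_floor.comp ((measurable_pi_apply l).const_mul _)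

lemma measurableSet_cell (i : ℕ) (κ : Fin n → ℤ) : MeasurableSet (cell i κ) :=
  measurable_cellIdx i (measurableSet_singleton κ)

lemma measurable_comp_cellIdx {α : Type*} [MeasurableSpace α] (i : ℕ) (H : (Fin n → ℤ) → α) :
    Measurable fun x => H (cellIdx i x) :=
  (measurable_of_countable H).comp (measurable_cellIdx i)

lemma cellIdx_mem_cellBox {i : ℕ} {x : Fin n → ℝ} (hx : x ∈ cube n) :
    cellIdx i x ∈ cellBox n i := by
  rw [cellBox, Fintype.mem_piFinset]
  intro l
  have h := hx l (Set.mem_univ l)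
  rw [Finset.mem_Ico, cellIdx, Int.le_floor, Int.floor_lt]
  have hp : (0 : ℝ) < 2 ^ i := by positivity
  constructor
  · push_cast; exact mul_nonneg hp.le h.1
  · push_cast; nlinarith [h.2]

lemma cell_eq_pi (i : ℕ) (κ : Fin n → ℤ) :
    cell i κ = Set.univ.pi fun l => Set.Ico ((κ l : ℝ) / 2 ^ i) (((κ l : ℝ) + 1) / 2 ^ i) := by
  have hp : (0 : ℝ) < 2 ^ i := by positivity
  ext x
  simp only [cell, cellIdx, Set.mem_ofPred_eq, Set.mem_univ_pi, Set.mem_Ico, funext_iff,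
    Int.floor_eq_iff, div_le_iff₀ hp, lt_div_iff₀ hp, mul_comm (x _)]

lemma cell_subset_cube {i : ℕ} {κ : Fin n → ℤ} (hκ : κ ∈ cellBox n i) : cell i κ ⊆ cube n := by
  rw [cellBox, Fintype.mem_piFinset] at hκ
  rw [cell_eq_pi]
  refine Set.pi_mono fun l _ => Set.Ico_subset_Ico ?_ ?_
  · have := (Finset.mem_Ico.1 (hκ l)).1
    have : (0 : ℝ) ≤ κ l := by exact_mod_cast this
    positivity
  · have := Int.add_one_le_iff.2 (Finset.mem_Ico.1 (hκ l)).2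
    rw [div_le_one (by positivity)]
    exact_mod_cast this

lemma μT_cell {i : ℕ} {κ : Fin n → ℤ} (hκ : κ ∈ cellBox n i) :
    μT n (cell i κ) = ENNReal.ofReal (((2 : ℝ) ^ i) ^ n)⁻¹ := by
  rw [μT, Measure.restrict_eq_self _ (cell_subset_cube hκ), cell_eq_pi, Real.volume_pi_Ico]
  have : ∀ l : Fin n, (((κ l : ℝ) + 1) / 2 ^ i - (κ l : ℝ) / 2 ^ i) = (2 ^ i)⁻¹ := fun l => by ring
  simp only [this]
  rw [Finset.prod_const, Finset.card_univ, Fintype.card_fin, ← ENNReal.ofReal_pow (by positivity),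
    inv_pow]

lemma μT_real_cell {i : ℕ} {κ : Fin n → ℤ} (hκ : κ ∈ cellBox n i) :
    (μT n).real (cell i κ) = (((2 : ℝ) ^ i) ^ n)⁻¹ := by
  rw [measureReal_def, μT_cell hκ, ENNReal.toReal_ofReal (by positivity)]

lemma cellIdx_eq_of_succ {i : ℕ} {x y : Fin n → ℝ} (h : cellIdx (i + 1) x = cellIdx (i + 1) y) :
    cellIdx i x = cellIdx i y := by
  have key : ∀ z : Fin n → ℝ, ∀ l, cellIdx i z l = cellIdx (i + 1) z l / 2 := fun z l => by
    rw [cellIdx, cellIdx]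
    have := Int.floor_div_natCast ((2 : ℝ) ^ (i + 1) * z l) 2
    rw [show (2 : ℝ) ^ (i + 1) * z l / (2 : ℕ) = 2 ^ i * z l by push_cast; ring] at this
    exact_mod_cast this
  funext l
  rw [key, key, h]

lemma cellIdx_eq_of_le {i j : ℕ} (hij : i ≤ j) {x y : Fin n → ℝ}
    (h : cellIdx j x = cellIdx j y) : cellIdx i x = cellIdx i y := by
  induction hij with
  | refl => exact h
  | step _ ih => exact ih (cellIdx_eq_of_succ h)

lemma abs_sub_le_of_cellIdx_eq {i : ℕ} {x y : Fin n → ℝ} (h : cellIdx i x = cellIdx i y)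
    (l : Fin n) : |x l - y l| ≤ (2 ^ i)⁻¹ := by
  have hp : (0 : ℝ) < 2 ^ i := by positivity
  have := (Int.abs_sub_lt_one_of_floor_eq_floor (congrFun h l)).le
  rw [← mul_sub, abs_mul, abs_of_pos hp] at this
  rwa [inv_eq_one_div, le_div_iff₀' hp]

lemma ae_mem_cube : ∀ᵐ x ∂μT n, x ∈ cube n := ae_restrict_mem (measurableSet_cube n)

section cellAvg
variable {𝕜 : Type*} [RCLike 𝕜]

lemma cellAvg_congr {i : ℕ} (u : (Fin n → ℝ) → 𝕜) {x y : Fin n → ℝ}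
    (h : cellIdx i x = cellIdx i y) : cellAvg i u x = cellAvg i u y := by
  rw [cellAvg, cellAvg, h]

lemma measurable_cellAvg (i : ℕ) (u : (Fin n → ℝ) → 𝕜) : Measurable (cellAvg i u) :=
  measurable_comp_cellIdx i fun κ => ((2 : 𝕜) ^ i) ^ n * ∫ y in cell i κ, u y ∂μT n

lemma norm_cellAvg_le (i : ℕ) (u : (Fin n → ℝ) → 𝕜) (x : Fin n → ℝ) :
    ‖cellAvg i u x‖ ≤ cellAvg i (fun y => ‖u y‖) x := by
  rw [cellAvg, norm_mul, cellAvg]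
  simp only [norm_pow, RCLike.norm_two]
  gcongr
  exact norm_integral_le_integral_norm _

lemma integrable_cellAvg (i : ℕ) {u : (Fin n → ℝ) → 𝕜} (hu : Integrable u (μT n)) :
    Integrable (cellAvg i u) (μT n) := by
  refine Integrable.of_bound (measurable_cellAvg i u).aestronglyMeasurable
    (((2 : ℝ) ^ i) ^ n * ∫ y, ‖u y‖ ∂μT n) (Filter.Eventually.of_forall fun x => ?_)
  refine (norm_cellAvg_le i u x).trans ?_
  rw [cellAvg]
  refine mul_le_mul_of_nonneg_left ?_ (by positivity)
  exact setIntegral_le_integral hu.norm (Filter.Eventually.of_forall fun y => norm_nonneg _)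

lemma integral_eq_sum_cells (i : ℕ) {F : (Fin n → ℝ) → 𝕜} (hF : ∀ κ, IntegrableOn F (cell i κ) (μT n)) :
    ∫ x, F x ∂μT n = ∑ κ ∈ cellBox n i, ∫ x in cell i κ, F x ∂μT n := by
  have hU : (⋃ κ ∈ cellBox n i, cell i κ) =ᵐ[μT n] Set.univ := by
    rw [Filter.eventuallyEq_univ]
    filter_upwards [ae_mem_cube] with x hx
    exact Set.mem_biUnion (cellIdx_mem_cellBox hx) rfl
  rw [← setIntegral_univ, ← setIntegral_congr_set hU,
    integral_biUnion_finset _ (fun κ _ => measurableSet_cell i κ) _ fun κ _ => hF κ]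
  intro κ _ κ' _ hne
  exact Set.disjoint_left.2 fun x hx hx' => hne (hx.symm.trans hx')

/-- Averaging over cells is dual to functions that are constant on cells. -/
lemma integral_mul_cellAvg (i : ℕ) {u : (Fin n → ℝ) → 𝕜} (hu : Integrable u (μT n))
    (H : (Fin n → ℤ) → 𝕜) :
    ∫ x, H (cellIdx i x) * cellAvg i u x ∂μT n = ∫ x, H (cellIdx i x) * u x ∂μT n := by
  have hi : ∀ v : (Fin n → ℝ) → 𝕜, Integrable v (μT n) → ∀ κ,
      IntegrableOn (fun x => H (cellIdx i x) * v x) (cell i κ) (μT n) := fun v hv κ =>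
    IntegrableOn.congr_fun (f := fun x => H κ * v x) (hv.integrableOn.const_mul (H κ)) (fun x hx => by
      rw [show cellIdx i x = κ from hx]) (measurableSet_cell i κ)
  rw [integral_eq_sum_cells i (hi _ (integrable_cellAvg i hu)),
    integral_eq_sum_cells i (hi _ hu)]
  refine Finset.sum_congr rfl fun κ hκ => ?_
  have e1 : ∫ x in cell i κ, H (cellIdx i x) * u x ∂μT n = H κ * ∫ x in cell i κ, u x ∂μT n := by
    rw [← integral_const_mul]
    exact setIntegral_congr_fun (measurableSet_cell i κ) fun x hx => by
      simp only [show cellIdx i x = κ from hx]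
  have e2 : ∫ x in cell i κ, H (cellIdx i x) * cellAvg i u x ∂μT n
      = ∫ x in cell i κ, H κ * (((2 : 𝕜) ^ i) ^ n * ∫ y in cell i κ, u y ∂μT n) ∂μT n :=
    setIntegral_congr_fun (measurableSet_cell i κ) fun x hx => by
      simp only [cellAvg, show cellIdx i x = κ from hx]
  rw [e1, e2, setIntegral_const, μT_real_cell hκ, RCLike.real_smul_eq_coe_mul]
  have : ((2 : 𝕜) ^ i) ^ n ≠ 0 := pow_ne_zero _ (pow_ne_zero _ two_ne_zero)
  push_cast
  field_simp

end cellAvg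

lemma cellAvg_zero {u : (Fin n → ℝ) → ℝ} {x : Fin n → ℝ} (hx : x ∈ cube n) :
    cellAvg 0 u x = ∫ y, u y ∂μT n := by
  have : cell 0 (cellIdx 0 x) =ᵐ[μT n] Set.univ := by
    rw [Filter.eventuallyEq_univ]
    filter_upwards [ae_mem_cube] with y hy
    have h1 := cellIdx_mem_cellBox (i := 0) hx
    have h2 := cellIdx_mem_cellBox (i := 0) hy
    simp only [cellBox, pow_zero, Fintype.mem_piFinset, Finset.mem_Ico] at h1 h2
    funext l
    have := h1 l
    have := h2 l
    lia
  rw [cellAvg, setIntegral_congr_set this, setIntegral_univ]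
  simp

lemma cellAvg_succ_le (i : ℕ) {u : (Fin n → ℝ) → ℝ} (hu : ∀ x, 0 ≤ u x)
    (hi : Integrable u (μT n)) (x : Fin n → ℝ) :
    cellAvg (i + 1) u x ≤ 2 ^ n * cellAvg i u x := by
  rw [cellAvg, cellAvg, ← mul_assoc, ← mul_pow, ← pow_succ']
  refine mul_le_mul_of_nonneg_left ?_ (by positivity)
  exact setIntegral_mono_set hi.integrableOn (Filter.Eventually.of_forall hu)
    (Filter.Eventually.of_forall fun y hy => cellIdx_eq_of_succ hy)

lemma le_cellAvg_add (i : ℕ) {u : (Fin n → ℝ) → ℝ} (hi : Integrable u (μT n)) {x : Fin n → ℝ}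
    (hx : x ∈ cube n) {δ : ℝ} (hδ : ∀ y ∈ cube n, cellIdx i y = cellIdx i x → u x ≤ u y + δ) :
    u x ≤ cellAvg i u x + δ := by
  have hκ := cellIdx_mem_cellBox (i := i) hx
  have h : ∫ y in cell i (cellIdx i x), (u x - δ) ∂μT n ≤ ∫ y in cell i (cellIdx i x), u y ∂μT n :=
    setIntegral_mono_on (integrable_const _).integrableOn hi.integrableOn (measurableSet_cell _ _)
      fun y hy => by linarith [hδ y (cell_subset_cube hκ hy) hy]
  rw [setIntegral_const, μT_real_cell hκ, smul_eq_mul, inv_mul_le_iff₀ (by positivity)] at h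
  rw [cellAvg]
  linarith

/-- The union of the dyadic cells of side `2^{-i}` selected by the Calderón–Zygmund stopping time
at height `t`. -/
def stopSet (f : (Fin n → ℝ) → ℂ) (t : ℝ) (i : ℕ) : Set (Fin n → ℝ) :=
  {x | t < cellAvg i (fun y => ‖f y‖) x ∧ ∀ i' < i, cellAvg i' (fun y => ‖f y‖) x ≤ t}

/-- The part of `f` of mean zero on the cells of generation `i`. -/
def badPart (f : (Fin n → ℝ) → ℂ) (t : ℝ) (i : ℕ) : (Fin n → ℝ) → ℂ :=
  (stopSet f t i).indicator fun x => f x - cellAvg i f x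

/-- The bounded part of the Calderón–Zygmund decomposition. -/
def goodPart (f : (Fin n → ℝ) → ℂ) (t : ℝ) (N : ℕ) (x : Fin n → ℝ) : ℂ :=
  f x - ∑ i ∈ Finset.range (N + 1), badPart f t i x

lemma mem_stopSet_congr {f : (Fin n → ℝ) → ℂ} {t : ℝ} {i : ℕ} {x y : Fin n → ℝ}
    (h : cellIdx i x = cellIdx i y) (hx : x ∈ stopSet f t i) : y ∈ stopSet f t i :=
  ⟨hx.1.trans_eq (cellAvg_congr _ h), fun i' hi' =>
    (cellAvg_congr _ (cellIdx_eq_of_le hi'.le h)).symm.trans_le (hx.2 i' hi')⟩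

lemma mem_stopSet_iff_exists {f : (Fin n → ℝ) → ℂ} {t : ℝ} {i : ℕ} {x : Fin n → ℝ} :
    x ∈ stopSet f t i ↔ cellIdx i x ∈ cellIdx i '' stopSet f t i :=
  ⟨fun h => ⟨x, h, rfl⟩, fun ⟨_, hy, h⟩ => mem_stopSet_congr h hy⟩

lemma measurableSet_stopSet (f : (Fin n → ℝ) → ℂ) (t : ℝ) (i : ℕ) :
    MeasurableSet (stopSet f t i) := by
  have : stopSet f t i = cellIdx i ⁻¹' (cellIdx i '' stopSet f t i) := by
    ext x; exact mem_stopSet_iff_exists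
  rw [this]
  exact measurable_cellIdx i (Set.to_countable _).measurableSet

lemma eq_of_mem_stopSet {f : (Fin n → ℝ) → ℂ} {t : ℝ} {i j : ℕ} {x : Fin n → ℝ}
    (hi : x ∈ stopSet f t i) (hj : x ∈ stopSet f t j) : i = j := by
  rcases lt_trichotomy i j with h | h | h
  · exact absurd (hj.2 i h) (not_le.2 hi.1)
  · exact h
  · exact absurd (hi.2 j h) (not_le.2 hj.1)

lemma measurable_badPart {f : (Fin n → ℝ) → ℂ} (hf : Measurable f) (t : ℝ) (i : ℕ) :
    Measurable (badPart f t i) :=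
  (hf.sub (measurable_cellAvg i f)).indicator (measurableSet_stopSet f t i)

lemma integrable_badPart {f : (Fin n → ℝ) → ℂ} (hf : Integrable f (μT n)) (t : ℝ) (i : ℕ) :
    Integrable (badPart f t i) (μT n) :=
  (hf.sub (integrable_cellAvg i hf)).indicator (measurableSet_stopSet f t i)

lemma integrable_goodPart {f : (Fin n → ℝ) → ℂ} (hf : Integrable f (μT n)) (t : ℝ) (N : ℕ) :
    Integrable (goodPart f t N) (μT n) :=
  hf.sub (integrable_finsetSum _ fun i _ => integrable_badPart hf t i)

lemma measurable_goodPart {f : (Fin n → ℝ) → ℂ} (hf : Measurable f) (t : ℝ) (N : ℕ) :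
    Measurable (goodPart f t N) :=
  hf.sub (Finset.measurable_fun_sum _ fun i _ => measurable_badPart hf t i)

/-- The bad parts are orthogonal to functions that are constant on cells. -/
lemma integral_mul_badPart {f : (Fin n → ℝ) → ℂ} (hf : Integrable f (μT n)) (t : ℝ) (i : ℕ)
    (H : (Fin n → ℤ) → ℂ) : ∫ y, H (cellIdx i y) * badPart f t i y ∂μT n = 0 := by
  classical
  set H' : (Fin n → ℤ) → ℂ := fun κ => if κ ∈ cellIdx i '' stopSet f t i then H κ else 0
  have e : ∀ y, H (cellIdx i y) * badPart f t i y
      = H' (cellIdx i y) * f y - H' (cellIdx i y) * cellAvg i f y := fun y => by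
    by_cases hy : y ∈ stopSet f t i
    · simp only [badPart, Set.indicator_of_mem hy, H', if_pos (mem_stopSet_iff_exists.1 hy)]
      ring
    · simp only [badPart, Set.indicator_of_notMem hy, H',
        if_neg (fun h => hy (mem_stopSet_iff_exists.2 h))]
      ring
  have hb : ∃ C, ∀ᵐ y ∂μT n, ‖H' (cellIdx i y)‖ ≤ C := by
    refine ⟨∑ κ ∈ cellBox n i, ‖H' κ‖, ?_⟩
    filter_upwards [ae_mem_cube] with y hy
    exact Finset.single_le_sum (f := fun κ => ‖H' κ‖) (fun κ _ => norm_nonneg _)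
      (cellIdx_mem_cellBox hy)
  obtain ⟨C, hC⟩ := hb
  have hm := (measurable_comp_cellIdx i H').aestronglyMeasurable (μ := μT n)
  simp only [e]
  rw [integral_sub (hf.bdd_mul hm hC) ((integrable_cellAvg i hf).bdd_mul hm hC),
    integral_mul_cellAvg i hf H', sub_self]

lemma setIntegral_stopSet_cellAvg {f : (Fin n → ℝ) → ℂ} (hf : Integrable f (μT n)) (t : ℝ)
    (i : ℕ) : ∫ x in stopSet f t i, cellAvg i (fun y => ‖f y‖) x ∂μT n
      = ∫ x in stopSet f t i, ‖f x‖ ∂μT n := by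
  classical
  have h := integral_mul_cellAvg i hf.norm
    fun κ => if κ ∈ cellIdx i '' stopSet f t i then (1 : ℝ) else 0
  rw [← integral_indicator (measurableSet_stopSet f t i),
    ← integral_indicator (measurableSet_stopSet f t i)]
  simp only [← mem_stopSet_iff_exists, ite_mul, one_mul, zero_mul] at h
  simpa only [Set.indicator_apply] using h

lemma integral_norm_badPart_le {f : (Fin n → ℝ) → ℂ} (hf : Integrable f (μT n)) (t : ℝ) (i : ℕ) :
    ∫ x, ‖badPart f t i x‖ ∂μT n ≤ 2 * ∫ x in stopSet f t i, ‖f x‖ ∂μT n := by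
  have e : ∀ x, ‖badPart f t i x‖ = (stopSet f t i).indicator (fun x => ‖f x - cellAvg i f x‖) x :=
    fun x => by rw [badPart, norm_indicator_eq_indicator_norm]
  simp only [e]
  rw [integral_indicator (measurableSet_stopSet f t i), two_mul]
  nth_rw 2 [← setIntegral_stopSet_cellAvg hf]
  rw [← integral_add hf.norm.integrableOn (integrable_cellAvg i hf.norm).integrableOn]
  refine integral_mono (hf.sub (integrable_cellAvg i hf)).norm.integrableOn
    (hf.norm.add (integrable_cellAvg i hf.norm)).integrableOn fun x => ?_
  exact (norm_sub_le _ _).trans (add_le_add le_rfl (norm_cellAvg_le i f x))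

lemma sum_setIntegral_stopSet_le {f : (Fin n → ℝ) → ℂ} (hf : Integrable f (μT n)) (t : ℝ)
    (s : Finset ℕ) :
    ∑ i ∈ s, ∫ x in stopSet f t i, ‖f x‖ ∂μT n ≤ ∫ x, ‖f x‖ ∂μT n := by
  rw [← integral_biUnion_finset s (fun i _ => measurableSet_stopSet f t i)
    (fun i _ j _ hne => Set.disjoint_left.2 fun x hi hj => hne (eq_of_mem_stopSet hi hj))
    fun i _ => hf.norm.integrableOn]
  exact setIntegral_le_integral hf.norm (Filter.Eventually.of_forall fun x => norm_nonneg _)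

lemma sum_integral_norm_badPart_le {f : (Fin n → ℝ) → ℂ} (hf : Integrable f (μT n)) (t : ℝ)
    (s : Finset ℕ) :
    ∑ i ∈ s, ∫ x, ‖badPart f t i x‖ ∂μT n ≤ 2 * ∫ x, ‖f x‖ ∂μT n := by
  refine (Finset.sum_le_sum fun i _ => integral_norm_badPart_le hf t i).trans ?_
  rw [← Finset.mul_sum]
  exact mul_le_mul_of_nonneg_left (sum_setIntegral_stopSet_le hf t s) zero_le_two

lemma integral_norm_goodPart_le {f : (Fin n → ℝ) → ℂ} (hf : Integrable f (μT n)) (t : ℝ) (N : ℕ) :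
    ∫ x, ‖goodPart f t N x‖ ∂μT n ≤ 3 * ∫ x, ‖f x‖ ∂μT n := by
  have hb : ∀ i ∈ Finset.range (N + 1), Integrable (fun x => ‖badPart f t i x‖) (μT n) :=
    fun i _ => (integrable_badPart hf t i).norm
  calc _ ≤ ∫ x, (‖f x‖ + ∑ i ∈ Finset.range (N + 1), ‖badPart f t i x‖) ∂μT n :=
        integral_mono (integrable_goodPart hf t N).norm (hf.norm.add (integrable_finsetSum _ hb))
          fun x => (norm_sub_le _ _).trans (add_le_add le_rfl (norm_sum_le _ _))
    _ = ∫ x, ‖f x‖ ∂μT n + ∑ i ∈ Finset.range (N + 1), ∫ x, ‖badPart f t i x‖ ∂μT n := by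
        rw [integral_add hf.norm (integrable_finsetSum _ hb), integral_finsetSum _ hb]
    _ ≤ _ := by linarith [sum_integral_norm_badPart_le hf t (Finset.range (N + 1))]

lemma norm_goodPart_le {f : (Fin n → ℝ) → ℂ} (hf : Integrable f (μT n)) {t : ℝ} (ht : 0 < t)
    (hft : ∫ x, ‖f x‖ ∂μT n ≤ t) {N : ℕ}
    (hN : ∀ x ∈ cube n, ∀ y ∈ cube n, cellIdx N x = cellIdx N y → ‖f x - f y‖ ≤ t)
    {x : Fin n → ℝ} (hx : x ∈ cube n) : ‖goodPart f t N x‖ ≤ 2 ^ n * (2 * t) := by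
  have h2 : (1 : ℝ) ≤ 2 ^ n := one_le_pow₀ one_le_two
  by_cases h : ∃ i ≤ N, x ∈ stopSet f t i
  · obtain ⟨i, hi, hxi⟩ := h
    have e : goodPart f t N x = cellAvg i f x := by
      rw [goodPart, Finset.sum_eq_single i, badPart, Set.indicator_of_mem hxi]
      · ring
      · exact fun j _ hj => Set.indicator_of_notMem (fun hxj => hj (eq_of_mem_stopSet hxj hxi)) _
      · exact fun h => absurd (Finset.mem_range.2 (Nat.lt_succ_of_le hi)) h
    rw [e]
    refine (norm_cellAvg_le i f x).trans ?_
    cases i with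
    | zero =>
      rw [cellAvg_zero hx]
      nlinarith
    | succ i =>
      refine (cellAvg_succ_le i (fun y => norm_nonneg _) hf.norm x).trans ?_
      have := hxi.2 i (Nat.lt_succ_self i)
      gcongr
      linarith
  · push Not at h
    have e : goodPart f t N x = f x := by
      rw [goodPart, Finset.sum_eq_zero, sub_zero]
      exact fun i hi => Set.indicator_of_notMem (h i (Nat.lt_succ_iff.1 (Finset.mem_range.1 hi))) _
    have hM : ∀ i ≤ N, cellAvg i (fun y => ‖f y‖) x ≤ t := by
      intro i
      induction i using Nat.strong_induction_on with
      | _ i ih =>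
        intro hi
        by_contra! hc
        exact h i hi ⟨hc, fun i' hi' => ih i' hi' (by lia)⟩
    have := le_cellAvg_add N hf.norm hx (δ := t) fun y hy hxy => by
      have := hN x hx y hy hxy.symm
      linarith [norm_sub_norm_le (f x) (f y)]
    rw [e]
    nlinarith [hM N le_rfl]

lemma exists_oscillation_le {f : (Fin n → ℝ) → ℂ} (hf : Continuous f) {t : ℝ} (ht : 0 < t) :
    ∃ N : ℕ, ∀ x ∈ cube n, ∀ y ∈ cube n, cellIdx N x = cellIdx N y → ‖f x - f y‖ ≤ t := by
  have hu := (isCompact_Icc (a := (0 : Fin n → ℝ)) (b := 1)).uniformContinuousOn_of_continuous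
    hf.continuousOn
  obtain ⟨δ, hδ, h⟩ := Metric.uniformContinuousOn_iff_le.1 hu t ht
  obtain ⟨N, hN⟩ := exists_pow_lt_of_lt_one hδ (show (1 / 2 : ℝ) < 1 by norm_num)
  refine ⟨N, fun x hx y hy hxy => ?_⟩
  rw [← dist_eq_norm]
  refine h x (cube_subset_Icc n hx) y (cube_subset_Icc n hy) ?_
  refine (dist_pi_le_iff hδ.le).2 fun l => (abs_sub_le_of_cellIdx_eq hxy l).trans ?_
  rw [← inv_pow, inv_eq_one_div]
  exact hN.le

lemma mul_measureReal_stopSet_le {f : (Fin n → ℝ) → ℂ} (hf : Integrable f (μT n)) (t : ℝ) (i : ℕ) :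
    t * (μT n).real (stopSet f t i) ≤ ∫ x in stopSet f t i, ‖f x‖ ∂μT n := by
  rw [← setIntegral_stopSet_cellAvg hf]
  calc t * (μT n).real (stopSet f t i) = ∫ x in stopSet f t i, t ∂μT n := by
        rw [setIntegral_const, smul_eq_mul, mul_comm]
    _ ≤ _ := setIntegral_mono_on (integrable_const _).integrableOn
        (integrable_cellAvg i hf.norm).integrableOn (measurableSet_stopSet f t i)
        fun x hx => hx.1.le

/-- The corner of the dyadic cell of side `2^{-i}` with index `κ`. -/
def cellCorner (i : ℕ) (κ : Fin n → ℤ) : Fin n → ℝ := fun l => κ l / 2 ^ i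

/-- A periodic neighbourhood of the cells selected at generation `i`. -/
def stopNhd (f : (Fin n → ℝ) → ℂ) (t : ℝ) (i : ℕ) : Set (Fin n → ℝ) :=
  {x | ∃ y ∈ stopSet f t i ∩ cube n,
    ∀ l, chord x (cellCorner i (cellIdx i y)) l < 8 * (2 ^ i)⁻¹}

lemma abs_cellCorner_sub_le (i : ℕ) (y : Fin n → ℝ) (l : Fin n) :
    |cellCorner i (cellIdx i y) l - y l| ≤ (2 ^ i)⁻¹ := by
  have hp : (0 : ℝ) < 2 ^ i := by positivity
  have h1 := Int.floor_le ((2 : ℝ) ^ i * y l)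
  have h2 := Int.lt_floor_add_one ((2 : ℝ) ^ i * y l)
  rw [cellCorner, cellIdx, inv_eq_one_div, le_div_iff₀' hp, ← abs_of_pos hp, ← abs_mul,
    abs_of_pos hp, mul_sub, mul_div_cancel₀ _ hp.ne', abs_le]
  constructor <;> linarith

lemma exists_le_chord_of_notMem_stopNhd {f : (Fin n → ℝ) → ℂ} {t : ℝ} {i : ℕ} {x y : Fin n → ℝ}
    (hx : x ∉ stopNhd f t i) (hy : y ∈ stopSet f t i) (hyc : y ∈ cube n) :
    ∃ l, (2 ^ i)⁻¹ ≤ chord x y l := by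
  by_contra! hc
  refine hx ⟨y, ⟨hy, hyc⟩, fun l => ?_⟩
  have h1 := norm_unitExp_sub_one_add_le (x l - y l) (y l - cellCorner i (cellIdx i y) l)
  rw [sub_add_sub_cancel] at h1
  have h2 := norm_unitExp_sub_one_le (y l - cellCorner i (cellIdx i y) l)
  rw [abs_sub_comm] at h2
  have h3 := abs_cellCorner_sub_le i y l
  have h4 := hc l
  rw [chord] at h4 ⊢
  have hp : (0 : ℝ) < (2 ^ i)⁻¹ := by positivity
  nlinarith [Real.pi_lt_d2, Real.pi_pos]

lemma exists_measure_chord_lt_le (hn : 1 ≤ n) :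
    ∃ C : ℝ, 0 < C ∧ ∀ r > 0, ∀ y : Fin n → ℝ,
      μT n {x | ∀ l, chord x y l < r} ≤ ENNReal.ofReal (C * r ^ n) := by
  obtain ⟨C, hC, h⟩ := exists_integral_inv_chordWeight_le (k := n) hn (by lia)
  refine ⟨(n + 1) * C, by positivity, fun r hr y => ?_⟩
  have hW : ∀ x, 0 < chordWeight n r y x := fun x => chordWeight_pos n hr y x
  have hc : Continuous fun x => (chordWeight n r y x)⁻¹ :=
    (continuous_chordWeight n r y).inv₀ fun x => (hW x).ne'
  have hmk := mul_meas_ge_le_integral_of_nonneg (μ := μT n)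
    (Filter.Eventually.of_forall fun x => (inv_pos.2 (hW x)).le) hc.integrable_μT
    (((n + 1) * r ^ (2 * n) : ℝ)⁻¹)
  have hsub : {x | ∀ l, chord x y l < r}
      ⊆ {x | ((n + 1) * r ^ (2 * n) : ℝ)⁻¹ ≤ (chordWeight n r y x)⁻¹} := fun x hx => by
    refine inv_anti₀ (hW x) ?_
    rw [chordWeight]
    have : ∑ l, chord x y l ^ (2 * n) ≤ ∑ l : Fin n, r ^ (2 * n) :=
      Finset.sum_le_sum fun l _ => pow_le_pow_left₀ (chord_nonneg _ _ _) (hx l).le _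
    simp only [Finset.sum_const, Finset.card_univ, Fintype.card_fin, nsmul_eq_mul] at this
    linarith
  refine (measure_mono hsub).trans ?_
  rw [← ENNReal.ofReal_toReal (measure_ne_top (μT n) _)]
  refine ENNReal.ofReal_le_ofReal ?_
  rw [inv_mul_le_iff₀ (by positivity)] at hmk
  refine hmk.trans ((mul_le_mul_of_nonneg_left (h r hr y) (by positivity)).trans_eq ?_)
  rw [show (n : ℝ) - 2 * (n : ℕ) = -(n : ℝ) by ring, Real.rpow_neg hr.le, Real.rpow_natCast, two_mul,
    pow_add]
  field_simp

lemma exists_measure_stopNhd_le (hn : 1 ≤ n) :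
    ∃ C : ℝ, 0 < C ∧ ∀ (f : (Fin n → ℝ) → ℂ) (t : ℝ) (i : ℕ),
      μT n (stopNhd f t i) ≤ ENNReal.ofReal C * μT n (stopSet f t i) := by
  classical
  obtain ⟨C, hC, h⟩ := exists_measure_chord_lt_le hn
  refine ⟨C * 8 ^ n, by positivity, fun f t i => ?_⟩
  set S := (cellBox n i).filter fun κ => κ ∈ cellIdx i '' stopSet f t i
  have hsub : stopNhd f t i ⊆ ⋃ κ ∈ S, {x | ∀ l, chord x (cellCorner i κ) l < 8 * (2 ^ i)⁻¹} := by
    rintro x ⟨y, ⟨hy, hyc⟩, hx⟩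
    refine Set.mem_biUnion (x := cellIdx i y) ?_ hx
    exact Finset.mem_filter.2 ⟨cellIdx_mem_cellBox hyc, y, hy, rfl⟩
  have hsub' : ⋃ κ ∈ S, cell i κ ⊆ stopSet f t i := by
    refine Set.iUnion₂_subset fun κ hκ x hx => ?_
    rw [mem_stopSet_iff_exists, show cellIdx i x = κ from hx]
    exact (Finset.mem_filter.1 hκ).2
  calc μT n (stopNhd f t i)
      ≤ ∑ κ ∈ S, μT n {x | ∀ l, chord x (cellCorner i κ) l < 8 * (2 ^ i)⁻¹} :=
        (measure_mono hsub).trans (measure_biUnion_finset_le _ _)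
    _ ≤ ∑ κ ∈ S, ENNReal.ofReal (C * 8 ^ n) * μT n (cell i κ) := by
        refine Finset.sum_le_sum fun κ hκ => (h _ (by positivity) _).trans_eq ?_
        rw [μT_cell (Finset.mem_filter.1 hκ).1, ← ENNReal.ofReal_mul (by positivity), mul_pow,
          inv_pow, mul_assoc]
    _ = ENNReal.ofReal (C * 8 ^ n) * μT n (⋃ κ ∈ S, cell i κ) := by
        rw [measure_biUnion_finset (fun κ _ κ' _ hne => Set.disjoint_left.2
          fun x hx hx' => hne (hx.symm.trans hx')) fun κ _ => measurableSet_cell i κ,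
          Finset.mul_sum]
    _ ≤ _ := by gcongr

lemma fc_eq_integral (h : (Fin n → ℝ) → ℂ) (ξ : Fin n → ℤ) :
    fc h ξ = ∫ y, eChar (-y) ξ * h y ∂μT n := by
  rw [fc]
  congr 1
  funext y
  rw [eChar]
  congr 2
  simp only [Pi.neg_apply, Complex.ofReal_neg, neg_mul, Finset.sum_neg_distrib, mul_neg]

lemma integrable_eChar_mul {h : (Fin n → ℝ) → ℂ} (hh : Integrable h (μT n)) (ξ : Fin n → ℤ) :
    Integrable (fun y => eChar (-y) ξ * h y) (μT n) :=
  hh.bdd_mul (c := 1) (by fun_prop : Continuous fun y : Fin n → ℝ => eChar (-y) ξ).aestronglyMeasurable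
    (Filter.Eventually.of_forall fun y => (norm_eChar _ _).le)

lemma fc_sub {g h : (Fin n → ℝ) → ℂ} (hg : Integrable g (μT n)) (hh : Integrable h (μT n))
    (ξ : Fin n → ℤ) : fc (fun x => g x - h x) ξ = fc g ξ - fc h ξ := by
  simp only [fc_eq_integral, mul_sub]
  exact integral_sub (integrable_eChar_mul hg ξ) (integrable_eChar_mul hh ξ)

lemma fc_sum {ι : Type*} (s : Finset ι) {h : ι → (Fin n → ℝ) → ℂ}
    (hh : ∀ i ∈ s, Integrable (h i) (μT n)) (ξ : Fin n → ℤ) :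
    fc (fun x => ∑ i ∈ s, h i x) ξ = ∑ i ∈ s, fc (h i) ξ := by
  simp only [fc_eq_integral, Finset.mul_sum]
  exact integral_finsetSum _ fun i hi => integrable_eChar_mul (hh i hi) ξ

/-- The periodic Fourier multiplier with symbol `τ`. -/
def multOp (τ : (Fin n → ℤ) → ℂ) (h : (Fin n → ℝ) → ℂ) : (Fin n → ℝ) → ℂ :=
  trigSum fun ξ => τ ξ * fc h ξ

section multOp
variable {τ : (Fin n → ℤ) → ℂ} {S : Finset (Fin n → ℤ)}

lemma continuous_multOp (hS : ∀ ξ ∉ S, τ ξ = 0) (h : (Fin n → ℝ) → ℂ) :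
    Continuous (multOp τ h) :=
  continuous_trigSum (S := S) fun ξ hξ => by rw [hS ξ hξ, zero_mul]

lemma multOp_eq_sum (hS : ∀ ξ ∉ S, τ ξ = 0) (h : (Fin n → ℝ) → ℂ) (x : Fin n → ℝ) :
    multOp τ h x = ∑ ξ ∈ S, τ ξ * fc h ξ * eChar x ξ :=
  trigSum_eq_sum (fun ξ hξ => by rw [hS ξ hξ, zero_mul]) x

lemma multOp_eq_integral (hS : ∀ ξ ∉ S, τ ξ = 0) {h : (Fin n → ℝ) → ℂ}
    (hh : Integrable h (μT n)) (x : Fin n → ℝ) :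
    multOp τ h x = ∫ y, trigSum τ (x - y) * h y ∂μT n := by
  simp only [multOp_eq_sum hS, trigSum_eq_sum hS, fc_eq_integral, Finset.sum_mul]
  rw [integral_finsetSum]
  · refine Finset.sum_congr rfl fun ξ _ => ?_
    rw [mul_right_comm, ← integral_const_mul]
    congr 1
    funext y
    rw [eChar_sub_left]; ring
  · intro ξ _
    refine ((integrable_eChar_mul hh ξ).const_mul (τ ξ * eChar x ξ)).congr
      (Filter.Eventually.of_forall fun y => ?_)
    simp only [eChar_sub_left]; ring

lemma sum_norm_fc_sq_le (S : Finset (Fin n → ℤ)) {h : (Fin n → ℝ) → ℂ}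
    (hh : Integrable h (μT n)) (hh2 : Integrable (fun x => ‖h x‖ ^ 2) (μT n)) :
    ∑ ξ ∈ S, ‖fc h ξ‖ ^ 2 ≤ ∫ x, ‖h x‖ ^ 2 ∂μT n := by
  set s : (Fin n → ℝ) → ℂ := fun x => ∑ ξ ∈ S, fc h ξ * eChar x ξ
  have hs : Continuous s := by fun_prop
  have hs2 : Integrable (fun x => ‖s x‖ ^ 2) (μT n) := Continuous.integrable_μT (by fun_prop)
  have e : ((∑ ξ ∈ S, ‖fc h ξ‖ ^ 2 : ℝ) : ℂ) = ∫ x, star (s x) * h x ∂μT n := by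
    have : ∀ x, star (s x) * h x = ∑ ξ ∈ S, star (fc h ξ) * (eChar (-x) ξ * h x) := fun x => by
      simp only [s, star_sum, star_mul', star_eChar, eChar_neg_left, Finset.sum_mul, mul_assoc]
    simp only [this]
    rw [integral_finsetSum _ fun ξ _ => (integrable_eChar_mul hh ξ).const_mul _]
    push_cast
    refine Finset.sum_congr rfl fun ξ _ => ?_
    rw [integral_const_mul, ← fc_eq_integral, Complex.star_def, mul_comm, Complex.mul_conj,
      Complex.normSq_eq_norm_sq]
    push_cast; rfl
  have h1 : ∑ ξ ∈ S, ‖fc h ξ‖ ^ 2 ≤ ∫ x, (‖s x‖ ^ 2 / 2 + ‖h x‖ ^ 2 / 2) ∂μT n := by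
    have h0 : 0 ≤ ∑ ξ ∈ S, ‖fc h ξ‖ ^ 2 := Finset.sum_nonneg fun _ _ => sq_nonneg _
    rw [← Real.norm_of_nonneg h0, ← Complex.norm_real, e]
    refine norm_integral_le_of_norm_le
      ((hs2.div_const 2).add (hh2.div_const 2))
      (Filter.Eventually.of_forall fun x => ?_)
    rw [norm_mul, norm_star]
    nlinarith [sq_nonneg (‖s x‖ - ‖h x‖)]
  rw [integral_add (hs2.div_const 2) (hh2.div_const 2),
    integral_div, integral_div, integral_norm_sq_sum_eChar] at h1
  linarith

lemma integral_norm_sq_multOp_le (hS : ∀ ξ ∉ S, τ ξ = 0) {A : ℝ} (hA : ∀ ξ, ‖τ ξ‖ ≤ A)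
    {h : (Fin n → ℝ) → ℂ} (hh : Integrable h (μT n))
    (hh2 : Integrable (fun x => ‖h x‖ ^ 2) (μT n)) :
    ∫ x, ‖multOp τ h x‖ ^ 2 ∂μT n ≤ A ^ 2 * ∫ x, ‖h x‖ ^ 2 ∂μT n := by
  simp only [multOp_eq_sum hS, integral_norm_sq_sum_eChar]
  refine le_trans ?_ (mul_le_mul_of_nonneg_left (sum_norm_fc_sq_le S hh hh2) (sq_nonneg A))
  rw [Finset.mul_sum]
  refine Finset.sum_le_sum fun ξ _ => ?_
  rw [norm_mul, mul_pow]
  gcongr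
  exact hA ξ

end multOp

/-- Schur-type bound for integral operators, in the form of a vector-valued Minkowski inequality. -/
lemma lintegral_enorm_le_of_kernel {Φ : (Fin n → ℝ) → (Fin n → ℝ) → ℂ}
    (hΦ : Measurable (Function.uncurry Φ)) {b T : (Fin n → ℝ) → ℂ} (hb : Measurable b)
    (hT : ∀ x, T x = ∫ y, Φ x y * b y ∂μT n) {s : Set (Fin n → ℝ)} {D : ℝ≥0∞}
    (hD : ∀ y ∈ cube n, b y ≠ 0 → ∫⁻ x in s, ‖Φ x y‖ₑ ∂μT n ≤ D) :
    ∫⁻ x in s, ‖T x‖ₑ ∂μT n ≤ D * ∫⁻ y, ‖b y‖ₑ ∂μT n := by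
  have hm : Measurable fun q : (Fin n → ℝ) × (Fin n → ℝ) => ‖Φ q.1 q.2‖ₑ * ‖b q.2‖ₑ :=
    hΦ.enorm.mul (hb.comp measurable_snd).enorm
  calc ∫⁻ x in s, ‖T x‖ₑ ∂μT n ≤ ∫⁻ x in s, ∫⁻ y, ‖Φ x y‖ₑ * ‖b y‖ₑ ∂μT n ∂μT n := by
        refine lintegral_mono fun x => ?_
        rw [hT x]
        refine (enorm_integral_le_lintegral_enorm _).trans_eq ?_
        simp only [enorm_mul]
    _ = ∫⁻ y, ∫⁻ x in s, ‖Φ x y‖ₑ * ‖b y‖ₑ ∂μT n ∂μT n :=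
        lintegral_lintegral_swap hm.aemeasurable
    _ ≤ ∫⁻ y, D * ‖b y‖ₑ ∂μT n := by
        refine lintegral_mono_ae ?_
        filter_upwards [ae_mem_cube] with y hy
        have hΦy : Measurable fun x => Φ x y := hΦ.comp measurable_prodMk_right
        rw [lintegral_mul_const _ hΦy.enorm]
        by_cases hby : b y = 0
        · simp [hby]
        · exact mul_le_mul_left (hD y hy hby) _
    _ = _ := lintegral_const_mul _ hb.enorm

lemma one_half_le_inv_sqrt_two : (1 / 2 : ℝ) ≤ (√2)⁻¹ := by
  rw [one_div]
  exact inv_anti₀ (by positivity) (by rw [Real.sqrt_le_left (by norm_num)]; norm_num)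

/-- Off-diagonal decay between frequency scale `2^j` and spatial scale `2^{-i}`. -/
lemma exists_lintegral_multOp_badPart_le (hn : 1 ≤ n) {k : ℕ} (hk : n < 2 * k) {B : ℝ} (hB : 0 < B) :
    ∃ C : ℝ, 0 < C ∧ ∀ (τ : (Fin n → ℤ) → ℂ) (j : ℕ), IsLocalizedSymbol k (2 ^ j) B τ →
      ∀ f : (Fin n → ℝ) → ℂ, Continuous f → ∀ (t : ℝ) (i : ℕ),
        ∫⁻ x in (stopNhd f t i)ᶜ, ‖multOp τ (badPart f t i) x‖ₑ ∂μT n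
          ≤ ENNReal.ofReal (C * (√2)⁻¹ ^ ((i - j) + (j - i)))
            * ∫⁻ y, ‖badPart f t i y‖ₑ ∂μT n := by
  obtain ⟨C₀, hC₀, h₀⟩ := exists_kernel_bound hn hk
  set E : ℝ := (4 * π) ^ k * (2 * π * n * (2 + k) + 1)
  have hE : 0 < E := by positivity
  refine ⟨C₀ * B + C₀ * (E * B), by positivity, fun τ j hτ f hf t i => ?_⟩
  have hR : (1 : ℝ) ≤ 2 ^ j := one_le_pow₀ one_le_two
  have hK := continuous_trigSum (fun ξ => hτ.apply_eq_zero (ξ := ξ))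
  have hbi := integrable_badPart hf.integrable_μT t i
  have hbm := measurable_badPart hf.measurable t i
  have hop := multOp_eq_integral (fun ξ => hτ.apply_eq_zero (ξ := ξ)) hbi
  rcases le_or_gt j i with hij | hij
  · have hc : Measurable fun y : Fin n → ℝ => cellCorner i (cellIdx i y) :=
      measurable_comp_cellIdx i (cellCorner i)
    refine lintegral_enorm_le_of_kernel
      (Φ := fun x y => trigSum τ (x - y) - trigSum τ (x - cellCorner i (cellIdx i y))) ?_ hbm ?_ ?_
    · exact (hK.measurable.comp (measurable_fst.sub measurable_snd)).sub
        (hK.measurable.comp (measurable_fst.sub (hc.comp measurable_snd)))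
    · intro x
      have hz := integral_mul_badPart hf.integrable_μT t i
        fun κ => trigSum τ (x - cellCorner i κ)
      have hbd : ∃ M, ∀ z : Fin n → ℝ, ‖trigSum τ z‖ ≤ M := by
        refine ⟨∑ ξ ∈ latticeBox n (⌊2 * (2 : ℝ) ^ j⌋₊ + k), ‖τ ξ‖, fun z => ?_⟩
        rw [trigSum_eq_sum (fun ξ => hτ.apply_eq_zero (ξ := ξ))]
        refine norm_sum_le_of_le _ fun ξ _ => ?_
        rw [norm_mul, norm_eChar, mul_one]
      obtain ⟨M, hM⟩ := hbd
      simp only [sub_mul]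
      rw [hop, integral_sub, hz, sub_zero]
      · exact hbi.bdd_mul (hK.comp (continuous_const.sub continuous_id)).aestronglyMeasurable
          (Filter.Eventually.of_forall fun y => hM _)
      · exact hbi.bdd_mul (hK.measurable.comp (hc.const_sub x)).aestronglyMeasurable
          (Filter.Eventually.of_forall fun y => hM _)
    · intro y hy _
      set c := cellCorner i (cellIdx i y)
      have hh : (0 : ℝ) < (2 ^ i)⁻¹ := by positivity
      have hpow : (2 ^ i)⁻¹ * (2 : ℝ) ^ j = (1 / 2) ^ (i - j) := by
        rw [one_div, inv_pow, pow_sub₀ _ two_ne_zero hij]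
        field_simp
      have hle : (2 ^ i)⁻¹ * (2 : ℝ) ^ j ≤ 1 := by
        rw [hpow]; exact pow_le_one₀ (by norm_num) (by norm_num)
      have hloc := hτ.mul_eChar_sub_one hR hB hh hle (u := c - y) (abs_cellCorner_sub_le i y)
      have hker := (h₀ _ _ _ hR (by positivity) hloc c).1
      have e : ∀ x, trigSum τ (x - y) - trigSum τ (x - c)
          = trigSum (fun ξ => τ ξ * (eChar (c - y) ξ - 1)) (x - c) := fun x => by
        rw [show x - y = (x - c) - (y - c) by abel, trigSum_sub_right τ (x - c) (y - c),
          trigSum_sub (fun ξ hξ => by rw [hτ.apply_eq_zero hξ, zero_mul])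
            fun ξ => hτ.apply_eq_zero (ξ := ξ)]
        simp only [neg_sub, mul_sub, mul_one]
      simp only [e]
      refine (setLIntegral_le_lintegral _ _).trans (hker.trans (ENNReal.ofReal_le_ofReal ?_))
      rw [hpow, Nat.sub_eq_zero_of_le hij, add_zero]
      have hq : (1 / 2 : ℝ) ^ (i - j) ≤ (√2)⁻¹ ^ (i - j) :=
        pow_le_pow_left₀ (by norm_num) one_half_le_inv_sqrt_two _
      have h1 : C₀ * (E * B * (1 / 2) ^ (i - j)) ≤ C₀ * (E * B * (√2)⁻¹ ^ (i - j)) := by gcongr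
      have h2 : 0 ≤ C₀ * B * (√2)⁻¹ ^ (i - j) := by positivity
      linarith
  · refine lintegral_enorm_le_of_kernel (Φ := fun x y => trigSum τ (x - y)) ?_ hbm hop ?_
    · exact hK.measurable.comp (measurable_fst.sub measurable_snd)
    · intro y hy hby
      have hys : y ∈ stopSet f t i := by
        by_contra h; exact hby (Set.indicator_of_notMem h _)
      have hker := (h₀ _ _ _ hR hB hτ y).2 (2 ^ i)⁻¹ (by positivity)
      refine (lintegral_mono_set fun x hx =>
        exists_le_chord_of_notMem_stopNhd hx hys hy).trans
        (hker.trans (ENNReal.ofReal_le_ofReal ?_))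
      have hpow : (2 ^ i)⁻¹ * (2 : ℝ) ^ j = 2 ^ (j - i) := by
        rw [pow_sub₀ _ two_ne_zero hij.le, mul_comm]
      have hq : ((2 : ℝ) ^ (j - i)) ^ ((n : ℝ) / 2 - k) ≤ (√2)⁻¹ ^ (j - i) := by
        have hk' : (n : ℝ) + 1 ≤ 2 * k := by exact_mod_cast hk
        have : (√2)⁻¹ = (2 : ℝ) ^ (-(1 / 2) : ℝ) := by
          rw [Real.rpow_neg zero_le_two, Real.sqrt_eq_rpow]
        rw [this, ← Real.rpow_pow_comm zero_le_two]
        refine pow_le_pow_left₀ (by positivity) (Real.rpow_le_rpow_of_exponent_le one_le_two ?_) _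
        linarith
      rw [hpow, Nat.sub_eq_zero_of_le hij.le, zero_add]
      have h1 : C₀ * B * ((2 : ℝ) ^ (j - i)) ^ ((n : ℝ) / 2 - k) ≤ C₀ * B * (√2)⁻¹ ^ (j - i) := by
        gcongr
      have h2 : 0 ≤ C₀ * (E * B) * (√2)⁻¹ ^ (j - i) := by positivity
      linarith

lemma sum_geometric_distance_le {q : ℝ} (hq0 : 0 ≤ q) (hq1 : q < 1) (i M : ℕ) :
    ∑ j ∈ Finset.range M, q ^ ((i - j) + (j - i)) ≤ 2 * (1 - q)⁻¹ := by
  have hg : ∀ N, ∑ j ∈ Finset.range N, q ^ j ≤ (1 - q)⁻¹ := fun N => by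
    rw [← tsum_geometric_of_lt_one hq0 hq1]
    exact (summable_geometric_of_lt_one hq0 hq1).sum_le_tsum _ fun j _ => pow_nonneg hq0 j
  calc _ ≤ ∑ j ∈ Finset.range (i + 1 + M), q ^ ((i - j) + (j - i)) :=
        Finset.sum_le_sum_of_subset_of_nonneg (Finset.range_subset_range.2 (by lia))
          fun j _ _ => pow_nonneg hq0 _
    _ = ∑ j ∈ Finset.range (i + 1), q ^ ((i - j) + (j - i))
        + ∑ j ∈ Finset.range M, q ^ ((i - (i + 1 + j)) + (i + 1 + j - i)) :=
        Finset.sum_range_add _ _ _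
    _ ≤ ∑ j ∈ Finset.range (i + 1), q ^ j + ∑ j ∈ Finset.range M, q ^ j := by
        refine add_le_add (le_of_eq ?_) (Finset.sum_le_sum fun j _ =>
          pow_le_pow_of_le_one hq0 hq1.le (by lia))
        rw [← Finset.sum_range_reflect]
        refine Finset.sum_congr rfl fun j hj => ?_
        have := Finset.mem_range.1 hj
        congr 1
        lia
    _ ≤ _ := by linarith [hg (i + 1), hg M]

lemma multOp_finsetSum {ι : Type*} (s : Finset ι) {τ : ι → (Fin n → ℤ) → ℂ}
    {S : ι → Finset (Fin n → ℤ)} (hS : ∀ j ∈ s, ∀ ξ ∉ S j, τ j ξ = 0) (h : (Fin n → ℝ) → ℂ)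
    (x : Fin n → ℝ) : multOp (fun ξ => ∑ j ∈ s, τ j ξ) h x = ∑ j ∈ s, multOp (τ j) h x := by
  simp only [multOp, trigSum, Finset.sum_mul]
  refine Summable.tsum_finsetSum fun j hj => summable_of_ne_finset_zero (s := S j) fun ξ hξ => ?_
  rw [hS j hj ξ hξ, zero_mul, zero_mul]

lemma multOp_eq_goodPart_add {τ : (Fin n → ℤ) → ℂ} {S : Finset (Fin n → ℤ)}
    (hS : ∀ ξ ∉ S, τ ξ = 0) {f : (Fin n → ℝ) → ℂ} (hf : Integrable f (μT n)) (t : ℝ) (N : ℕ)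
    (x : Fin n → ℝ) :
    multOp τ f x = multOp τ (goodPart f t N) x
      + ∑ i ∈ Finset.range (N + 1), multOp τ (badPart f t i) x := by
  have hb : ∀ i ∈ Finset.range (N + 1), Integrable (badPart f t i) (μT n) :=
    fun i _ => integrable_badPart hf t i
  have e : ∀ ξ, fc (goodPart f t N) ξ
      = fc f ξ - ∑ i ∈ Finset.range (N + 1), fc (badPart f t i) ξ := fun ξ => by
    rw [← fc_sum _ hb, ← fc_sub hf (integrable_finsetSum _ hb)]; rfl
  simp only [multOp_eq_sum hS, e]
  rw [Finset.sum_comm, ← Finset.sum_add_distrib]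
  refine Finset.sum_congr rfl fun ξ _ => ?_
  rw [← Finset.sum_mul, ← Finset.mul_sum]
  ring

lemma measure_goodPart_le {τ : (Fin n → ℤ) → ℂ} {S : Finset (Fin n → ℤ)}
    (hS : ∀ ξ ∉ S, τ ξ = 0) {A : ℝ} (hA : ∀ ξ, ‖τ ξ‖ ≤ A) {f : (Fin n → ℝ) → ℂ}
    (hf : Continuous f) {t : ℝ} (ht : 0 < t) (hft : ∫ x, ‖f x‖ ∂μT n ≤ t) {N : ℕ}
    (hN : ∀ x ∈ cube n, ∀ y ∈ cube n, cellIdx N x = cellIdx N y → ‖f x - f y‖ ≤ t) :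
    μT n {x | t / 2 ≤ ‖multOp τ (goodPart f t N) x‖}
      ≤ ENNReal.ofReal (24 * 2 ^ n * A ^ 2 * (∫ x, ‖f x‖ ∂μT n) / t) := by
  have hg := integrable_goodPart hf.integrable_μT t N
  have hbd : ∀ᵐ x ∂μT n, ‖goodPart f t N x‖ ^ 2 ≤ 2 ^ n * (2 * t) * ‖goodPart f t N x‖ := by
    filter_upwards [ae_mem_cube] with x hx
    rw [sq]
    exact mul_le_mul_of_nonneg_right (norm_goodPart_le hf.integrable_μT ht hft hN hx)
      (norm_nonneg _)
  have hg2 : Integrable (fun x => ‖goodPart f t N x‖ ^ 2) (μT n) :=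
    (hg.norm.const_mul (2 ^ n * (2 * t))).mono'
      ((measurable_goodPart hf.measurable t N).norm.pow_const 2).aestronglyMeasurable
      (hbd.mono fun x hx => by rwa [Real.norm_of_nonneg (sq_nonneg _)])
  have h1 : ∫ x, ‖goodPart f t N x‖ ^ 2 ∂μT n
      ≤ 2 ^ n * (2 * t) * (3 * ∫ x, ‖f x‖ ∂μT n) := by
    refine (integral_mono_ae hg2 (hg.norm.const_mul _) hbd).trans ?_
    rw [integral_const_mul]
    exact mul_le_mul_of_nonneg_left (integral_norm_goodPart_le hf.integrable_μT t N) (by positivity)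
  have h2 := (integral_norm_sq_multOp_le hS hA hg hg2).trans
    (mul_le_mul_of_nonneg_left h1 (sq_nonneg A))
  have hmk := mul_meas_ge_le_integral_of_nonneg (μ := μT n)
    (f := fun x => ‖multOp τ (goodPart f t N) x‖ ^ 2)
    (Filter.Eventually.of_forall fun x => sq_nonneg _)
    ((continuous_multOp hS _).norm.pow 2).integrable_μT ((t / 2) ^ 2)
  have hsub : {x | t / 2 ≤ ‖multOp τ (goodPart f t N) x‖}
      ⊆ {x | (t / 2) ^ 2 ≤ ‖multOp τ (goodPart f t N) x‖ ^ 2} :=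
    fun x hx => pow_le_pow_left₀ (half_pos ht).le hx 2
  refine (measure_mono hsub).trans
    ((ENNReal.ofReal_toReal (measure_ne_top (μT n) _)).symm.trans_le
      (ENNReal.ofReal_le_ofReal ?_))
  have h3 := hmk.trans h2
  rw [← le_div_iff₀' (by positivity)] at h3
  refine h3.trans_eq ?_
  field_simp
  ring

lemma measure_biUnion_stopNhd_le {C : ℝ} (hC : 0 ≤ C) {f : (Fin n → ℝ) → ℂ}
    (hf : Integrable f (μT n)) {t : ℝ} (ht : 0 < t)
    (h : ∀ i, μT n (stopNhd f t i) ≤ ENNReal.ofReal C * μT n (stopSet f t i)) (s : Finset ℕ) :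
    μT n (⋃ i ∈ s, stopNhd f t i) ≤ ENNReal.ofReal (C * (∫ x, ‖f x‖ ∂μT n) / t) := by
  calc μT n (⋃ i ∈ s, stopNhd f t i)
      ≤ ∑ i ∈ s, ENNReal.ofReal (C * (∫ x in stopSet f t i, ‖f x‖ ∂μT n) / t) := by
        refine (measure_biUnion_finset_le _ _).trans (Finset.sum_le_sum fun i _ => (h i).trans ?_)
        rw [← ENNReal.ofReal_toReal (measure_ne_top (μT n) (stopSet f t i)),
          ← ENNReal.ofReal_mul hC, mul_div_assoc]
        refine ENNReal.ofReal_le_ofReal (mul_le_mul_of_nonneg_left ?_ hC)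
        rw [le_div_iff₀' ht]
        exact mul_measureReal_stopSet_le hf t i
    _ = ENNReal.ofReal (C * (∑ i ∈ s, ∫ x in stopSet f t i, ‖f x‖ ∂μT n) / t) := by
        rw [Finset.mul_sum, Finset.sum_div, ENNReal.ofReal_sum_of_nonneg]
        intro i _
        have : 0 ≤ ∫ x in stopSet f t i, ‖f x‖ ∂μT n := integral_nonneg fun x => norm_nonneg _
        positivity
    _ ≤ _ := by
        refine ENNReal.ofReal_le_ofReal (div_le_div_of_nonneg_right ?_ ht.le)
        exact mul_le_mul_of_nonneg_left (sum_setIntegral_stopSet_le hf t s) hC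

/-- The frequency-truncated multipliers are of weak type `(1,1)`, uniformly in the truncation. -/
lemma exists_weak_type (hn : 1 ≤ n) {k : ℕ} (hk : n < 2 * k) {σ : (Fin n → ℤ) → ℂ} {A B : ℝ}
    (hA : ∀ ξ, ‖σ ξ‖ ≤ A) (hB : 0 < B)
    (hσ : ∀ j, IsLocalizedSymbol k (2 ^ j) B fun ξ => σ ξ * freqPiece j ξ) :
    ∃ C : ℝ, 0 < C ∧ ∀ (J : ℕ) (f : (Fin n → ℝ) → ℂ), Continuous f → ∀ t : ℝ, 0 < t →
      μT n {x | t < ‖multOp (fun ξ => σ ξ * freqCutoff (2 ^ J) ξ) f x‖}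
        ≤ ENNReal.ofReal (C * (∫ x, ‖f x‖ ∂μT n) / t) := by
  obtain ⟨C₁, hC₁, h₁⟩ := exists_measure_stopNhd_le hn
  obtain ⟨C₂, hC₂, h₂⟩ := exists_lintegral_multOp_badPart_le hn hk hB
  have hq0 : (0 : ℝ) ≤ (√2)⁻¹ := by positivity
  have hq1 : (√2 : ℝ)⁻¹ < 1 := inv_lt_one_of_one_lt₀ (by
    rw [Real.lt_sqrt zero_le_one]; norm_num)
  have hq2 : 0 < (1 - (√2 : ℝ)⁻¹)⁻¹ := inv_pos.2 (by linarith)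
  set C₃ : ℝ := C₂ * (2 * (1 - (√2)⁻¹)⁻¹)
  refine ⟨1 + 24 * 2 ^ n * A ^ 2 + C₁ + 4 * C₃, by positivity, fun J f hf t ht => ?_⟩
  set I : ℝ := ∫ x, ‖f x‖ ∂μT n
  have hI : 0 ≤ I := integral_nonneg fun x => norm_nonneg _
  rcases lt_or_ge t I with htI | htI
  · refine prob_le_one.trans ?_
    rw [ENNReal.one_le_ofReal, le_div_iff₀ ht, one_mul]
    have : 0 ≤ (24 * 2 ^ n * A ^ 2 + C₁ + 4 * C₃) * I := by positivity
    linarith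
  obtain ⟨N, hN⟩ := exists_oscillation_le hf ht
  have hfi := hf.integrable_μT
  set τ : (Fin n → ℤ) → ℂ := fun ξ => σ ξ * freqCutoff (2 ^ J) ξ
  have hτS : ∀ j ∈ Finset.range (J + 1), ∀ ξ ∉ latticeBox n (⌊2 * (2 : ℝ) ^ j⌋₊ + k),
      σ ξ * freqPiece j ξ = 0 := fun j _ ξ hξ => (hσ j).apply_eq_zero hξ
  have hτ : τ = fun ξ => ∑ j ∈ Finset.range (J + 1), σ ξ * freqPiece j ξ := by
    funext ξ
    rw [← Finset.mul_sum, sum_freqPiece]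
  obtain ⟨S, hS⟩ : ∃ S : Finset (Fin n → ℤ), ∀ ξ ∉ S, τ ξ = 0 := by
    classical
    refine ⟨(Finset.range (J + 1)).biUnion fun j => latticeBox n (⌊2 * (2 : ℝ) ^ j⌋₊ + k),
      fun ξ hξ => ?_⟩
    rw [hτ]
    refine Finset.sum_eq_zero fun j hj => hτS j hj ξ fun h => hξ ?_
    exact Finset.mem_biUnion.2 ⟨j, hj, h⟩
  have hτA : ∀ ξ, ‖τ ξ‖ ≤ A := fun ξ => by
    rw [norm_mul]
    exact (mul_le_of_le_one_right (norm_nonneg _) (norm_freqCutoff_le_one _ _)).trans (hA ξ)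
  set U : Set (Fin n → ℝ) := ⋃ i ∈ Finset.range (N + 1), stopNhd f t i
  set T : ℕ → ℕ → (Fin n → ℝ) → ℂ := fun i j =>
    multOp (fun ξ => σ ξ * freqPiece j ξ) (badPart f t i)
  have hTc : ∀ i j, Continuous (T i j) := fun i j =>
    continuous_multOp (fun ξ hξ => (hσ j).apply_eq_zero hξ) _
  set F : (Fin n → ℝ) → ℂ := fun x =>
    ∑ i ∈ Finset.range (N + 1), ∑ j ∈ Finset.range (J + 1), T i j x
  have hdec : ∀ x, multOp τ f x = multOp τ (goodPart f t N) x + F x := fun x => by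
    rw [multOp_eq_goodPart_add hS hfi t N x]
    congr 1
    refine Finset.sum_congr rfl fun i _ => ?_
    rw [hτ]
    exact multOp_finsetSum _ hτS _ x
  have hFint : ∫⁻ x in Uᶜ, ‖F x‖ₑ ∂μT n ≤ ENNReal.ofReal (C₃ * (2 * I)) := by
    calc ∫⁻ x in Uᶜ, ‖F x‖ₑ ∂μT n
        ≤ ∫⁻ x in Uᶜ, ∑ i ∈ Finset.range (N + 1), ∑ j ∈ Finset.range (J + 1), ‖T i j x‖ₑ ∂μT n :=
          lintegral_mono fun x => (enorm_sum_le _ _).trans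
            (Finset.sum_le_sum fun i _ => enorm_sum_le _ _)
      _ = ∑ i ∈ Finset.range (N + 1), ∑ j ∈ Finset.range (J + 1), ∫⁻ x in Uᶜ, ‖T i j x‖ₑ ∂μT n := by
          rw [lintegral_finsetSum _ fun i _ => Finset.measurable_fun_sum _
            fun j _ => (hTc i j).measurable.enorm]
          refine Finset.sum_congr rfl fun i _ => ?_
          rw [lintegral_finsetSum _ fun j _ => (hTc i j).measurable.enorm]
      _ ≤ ∑ i ∈ Finset.range (N + 1), ENNReal.ofReal (C₃ * ∫ y, ‖badPart f t i y‖ ∂μT n) := by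
          refine Finset.sum_le_sum fun i hi => ?_
          have hb : ∫⁻ y, ‖badPart f t i y‖ₑ ∂μT n
              = ENNReal.ofReal (∫ y, ‖badPart f t i y‖ ∂μT n) :=
            (ofReal_integral_norm_eq_lintegral_enorm (integrable_badPart hfi t i)).symm
          have hsub : Uᶜ ⊆ (stopNhd f t i)ᶜ :=
            Set.compl_subset_compl.2 (Set.subset_biUnion_of_mem (u := stopNhd f t) hi)
          refine (Finset.sum_le_sum fun j _ =>
            (lintegral_mono_set hsub).trans (h₂ _ j (hσ j) f hf t i)).trans ?_
          rw [← Finset.sum_mul, hb, ← ENNReal.ofReal_sum_of_nonneg fun j _ => by positivity,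
            ← Finset.mul_sum, ← ENNReal.ofReal_mul
              (mul_nonneg hC₂.le (Finset.sum_nonneg fun j _ => pow_nonneg hq0 _))]
          refine ENNReal.ofReal_le_ofReal (mul_le_mul_of_nonneg_right ?_
            (integral_nonneg fun y => norm_nonneg _))
          exact mul_le_mul_of_nonneg_left (sum_geometric_distance_le hq0 hq1 i (J + 1)) hC₂.le
      _ = ENNReal.ofReal (C₃ * ∑ i ∈ Finset.range (N + 1), ∫ y, ‖badPart f t i y‖ ∂μT n) := by
          rw [Finset.mul_sum, ENNReal.ofReal_sum_of_nonneg]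
          exact fun i _ => mul_nonneg (by positivity) (integral_nonneg fun y => norm_nonneg _)
      _ ≤ _ := by
          refine ENNReal.ofReal_le_ofReal (mul_le_mul_of_nonneg_left ?_ (by positivity))
          exact sum_integral_norm_badPart_le hfi t _
  have hFc : Measurable F := Finset.measurable_fun_sum _ fun i _ =>
    Finset.measurable_fun_sum _ fun j _ => (hTc i j).measurable
  have hFm : μT n ({x | t / 2 ≤ ‖F x‖} ∩ Uᶜ) ≤ ENNReal.ofReal (4 * C₃ * I / t) := by
    refine (Measure.le_restrict_apply _ _).trans ?_
    have h := mul_meas_ge_le_lintegral (μ := (μT n).restrict Uᶜ) hFc.enorm (ENNReal.ofReal (t / 2))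
    have e : {x | ENNReal.ofReal (t / 2) ≤ ‖F x‖ₑ} = {x | t / 2 ≤ ‖F x‖} := by
      ext x
      simp only [Set.mem_ofPred_eq, ← ofReal_norm, ENNReal.ofReal_le_ofReal_iff (norm_nonneg _)]
    rw [e] at h
    have h' := h.trans hFint
    rw [mul_comm, ← ENNReal.le_div_iff_mul_le (by left; simpa using ht) (by simp),
      ← ENNReal.ofReal_div_of_pos (by positivity)] at h'
    refine h'.trans_eq ?_
    congr 1
    field_simp
    ring
  have hsub : {x | t < ‖multOp τ f x‖} ⊆ {x | t / 2 ≤ ‖multOp τ (goodPart f t N) x‖}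
      ∪ (U ∪ ({x | t / 2 ≤ ‖F x‖} ∩ Uᶜ)) := fun x hx => by
    by_cases h1 : t / 2 ≤ ‖multOp τ (goodPart f t N) x‖
    · exact Or.inl h1
    by_cases h2 : x ∈ U
    · exact Or.inr (Or.inl h2)
    refine Or.inr (Or.inr ⟨?_, h2⟩)
    have hx' : t < ‖multOp τ f x‖ := hx
    rw [hdec] at hx'
    have := norm_add_le (multOp τ (goodPart f t N) x) (F x)
    change t / 2 ≤ ‖F x‖
    linarith
  refine (measure_mono hsub).trans ((measure_union_le _ _).trans ((add_le_add
    (measure_goodPart_le hS hτA hf ht htI hN) ((measure_union_le _ _).trans (add_le_add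
      (measure_biUnion_stopNhd_le hC₁.le hfi ht (h₁ f t) _) hFm))).trans ?_))
  rw [← ENNReal.ofReal_add (by positivity) (by positivity),
    ← ENNReal.ofReal_add (by positivity) (by positivity), ← add_div, ← add_div]
  refine ENNReal.ofReal_le_ofReal (div_le_div_of_nonneg_right ?_ ht.le)
  linarith

/-- Kolmogorov's inequality: weak `L¹` embeds into `L^p` of a probability space for `p < 1`. -/
lemma lintegral_rpow_le_of_weak_type {Ω : Type*} [MeasurableSpace Ω] {μ : Measure Ω}
    [IsProbabilityMeasure μ] {p C I : ℝ} (hp0 : 0 < p) (hp1 : p < 1) (hC : 0 ≤ C) (hI : 0 ≤ I)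
    {F : Ω → ℝ} (hF : Measurable F) (hF0 : ∀ x, 0 ≤ F x)
    (h : ∀ t, 0 < t → μ {x | t < F x} ≤ ENNReal.ofReal (C * I / t)) :
    ∫⁻ x, ENNReal.ofReal (F x ^ p) ∂μ ≤ ENNReal.ofReal ((1 + p * C / (1 - p)) * I ^ p) := by
  rw [lintegral_rpow_eq_lintegral_meas_lt_mul μ (Filter.Eventually.of_forall hF0) hF.aemeasurable
    hp0]
  rcases hI.eq_or_lt with rfl | hI
  · rw [setLIntegral_congr_fun (g := fun _ => 0) measurableSet_Ioi fun t ht => ?_]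
    · simp
    · have := h t ht
      simp only [mul_zero, zero_div, ofReal_zero, nonpos_iff_eq_zero] at this
      simp only [this, zero_mul]
  have hsmall : ∫⁻ t in Set.Ioc 0 I, μ {x | t < F x} * ENNReal.ofReal (t ^ (p - 1))
      ≤ ENNReal.ofReal (I ^ p / p) := by
    calc _ ≤ ∫⁻ t in Set.Ioc 0 I, ENNReal.ofReal (t ^ (p - 1)) :=
          lintegral_mono fun t => mul_le_of_le_one_left' prob_le_one
      _ = ENNReal.ofReal (∫ t in Set.Ioc 0 I, t ^ (p - 1)) := by
          rw [ofReal_integral_eq_lintegral_ofReal]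
          · exact (intervalIntegrable_iff_integrableOn_Ioc_of_le hI.le).1
              (intervalIntegral.intervalIntegrable_rpow' (by linarith))
          · exact (ae_restrict_mem measurableSet_Ioc).mono fun t ht => rpow_nonneg ht.1.le _
      _ = _ := by
          rw [← intervalIntegral.integral_of_le hI.le, integral_rpow (Or.inl (by linarith)),
            sub_add_cancel, zero_rpow hp0.ne', sub_zero]
  have hlarge : ∫⁻ t in Set.Ioi I, μ {x | t < F x} * ENNReal.ofReal (t ^ (p - 1))
      ≤ ENNReal.ofReal (C * I ^ p / (1 - p)) := by
    calc _ ≤ ∫⁻ t in Set.Ioi I, ENNReal.ofReal (C * I * t ^ (p - 2)) := by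
          refine setLIntegral_mono' measurableSet_Ioi fun t ht => ?_
          have ht0 : 0 < t := hI.trans ht
          refine (mul_le_mul_left (h t ht0) _).trans_eq ?_
          rw [← ENNReal.ofReal_mul (by positivity), div_mul_eq_mul_div, mul_div_assoc,
            ← rpow_sub_one ht0.ne', sub_sub, one_add_one_eq_two]
      _ = ENNReal.ofReal (∫ t in Set.Ioi I, C * I * t ^ (p - 2)) := by
          rw [ofReal_integral_eq_lintegral_ofReal]
          · exact (integrableOn_Ioi_rpow_of_lt (by linarith) hI).const_mul _
          · refine (ae_restrict_mem measurableSet_Ioi).mono fun t ht => ?_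
            exact mul_nonneg (by positivity) (rpow_nonneg (hI.trans ht).le _)
      _ = _ := by
          rw [integral_const_mul, integral_Ioi_rpow_of_lt (by linarith) hI,
            show p - 2 + 1 = p - 1 by ring, rpow_sub_one hI.ne']
          congr 1
          have : 1 - p ≠ 0 := by linarith
          have : p - 1 ≠ 0 := by linarith
          field_simp
          ring
  rw [← Set.Ioc_union_Ioi_eq_Ioi hI.le, lintegral_union measurableSet_Ioi Set.Ioc_disjoint_Ioi_same]
  refine (mul_le_mul_right (add_le_add hsmall hlarge) _).trans_eq ?_
  rw [← ENNReal.ofReal_add (by positivity) (div_nonneg (by positivity) (by linarith)),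
    ← ENNReal.ofReal_mul hp0.le]
  congr 1
  field_simp

lemma exists_finset_freqCutoff_eq_zero {R : ℝ} (hR : 0 < R) :
    ∃ S : Finset (Fin n → ℤ), ∀ ξ ∉ S, freqCutoff R ξ = 0 := by
  refine ⟨latticeBox n ⌈2 * R⌉₊, fun ξ hξ => freqCutoff_eq_zero hR ?_⟩
  obtain ⟨l, hl⟩ := exists_of_notMem_latticeBox hξ
  exact ⟨l, (Nat.le_ceil _).trans ((le_add_of_nonneg_right zero_le_one).trans hl)⟩

lemma tendsto_freqCutoff (ξ : Fin n → ℤ) :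
    Filter.Tendsto (fun J : ℕ => freqCutoff (2 ^ J) ξ) Filter.atTop (nhds 1) := by
  have h2 := tendsto_pow_atTop_atTop_of_one_lt (one_lt_two (α := ℝ))
  refine tendsto_const_nhds.congr' ?_
  filter_upwards [h2.eventually_ge_atTop (∑ l, |(ξ l : ℝ)|)] with J hJ
  refine (freqCutoff_eq_one (by positivity) fun l => ?_).symm
  exact (Finset.single_le_sum (f := fun l => |(ξ l : ℝ)|) (fun l _ => abs_nonneg _)
    (Finset.mem_univ l)).trans hJ

lemma Op_eq_zero {σ : (Fin n → ℤ) → ℂ} {f : (Fin n → ℝ) → ℂ}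
    (h : ¬Summable fun ξ => ‖σ ξ * fc f ξ‖) (x : Fin n → ℝ) : Op (fun _ => σ) f x = 0 := by
  refine tsum_eq_zero_of_not_summable fun hs => h ?_
  simpa only [norm_mul, norm_eChar, one_mul] using hs.norm

lemma tendsto_multOp_freqCutoff {σ : (Fin n → ℤ) → ℂ} {f : (Fin n → ℝ) → ℂ}
    (h : Summable fun ξ => ‖σ ξ * fc f ξ‖) (x : Fin n → ℝ) :
    Filter.Tendsto (fun J : ℕ => multOp (fun ξ => σ ξ * freqCutoff (2 ^ J) ξ) f x) Filter.atTop
      (nhds (Op (fun _ => σ) f x)) := by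
  refine tendsto_tsum_of_dominated_convergence h (fun ξ => ?_)
    (Filter.Eventually.of_forall fun J ξ => ?_)
  · have := ((tendsto_freqCutoff ξ).const_mul (σ ξ)).mul_const (fc f ξ * eChar x ξ)
    convert this using 2 <;> ring
  · change ‖σ ξ * freqCutoff (2 ^ J) ξ * fc f ξ * eChar x ξ‖ ≤ _
    rw [norm_mul, norm_eChar, mul_one, mul_right_comm, norm_mul _ (freqCutoff _ _)]
    exact mul_le_of_le_one_right (norm_nonneg _) (norm_freqCutoff_le_one _ _)

lemma lpT_Op_le {σ : (Fin n → ℤ) → ℂ} {p C I : ℝ} (hp0 : 0 < p) (hp1 : p < 1) (hC : 0 ≤ C)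
    (hI : 0 ≤ I) {f : (Fin n → ℝ) → ℂ}
    (h : ∀ (J : ℕ) (t : ℝ), 0 < t →
      μT n {x | t < ‖multOp (fun ξ => σ ξ * freqCutoff (2 ^ J) ξ) f x‖}
        ≤ ENNReal.ofReal (C * I / t)) :
    lpT n p (Op (fun _ => σ) f) ≤ (1 + p * C / (1 - p)) ^ (1 / p) * I := by
  have hK : 0 ≤ 1 + p * C / (1 - p) :=
    add_nonneg zero_le_one (div_nonneg (by positivity) (by linarith))
  by_cases hs : Summable fun ξ => ‖σ ξ * fc f ξ‖
  swap
  · have h0 : lpT n p (Op (fun _ => σ) f) = 0 := by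
      simp [lpT, Op_eq_zero hs, zero_rpow hp0.ne', zero_rpow (inv_ne_zero hp0.ne')]
    rw [h0]
    positivity
  have hm : ∀ J : ℕ, Measurable (multOp (fun ξ => σ ξ * freqCutoff (2 ^ J) ξ) f) := fun J => by
    obtain ⟨S, hS⟩ := exists_finset_freqCutoff_eq_zero (n := n) (R := 2 ^ J) (by positivity)
    exact (continuous_multOp (fun ξ hξ => by rw [hS ξ hξ, mul_zero]) f).measurable
  have hlim := tendsto_multOp_freqCutoff hs
  have hOp : Measurable (Op (fun _ => σ) f) :=
    measurable_of_tendsto_metrizable hm (tendsto_pi_nhds.2 hlim)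
  have key : ∫⁻ x, ENNReal.ofReal (‖Op (fun _ => σ) f x‖ ^ p) ∂μT n
      ≤ ENNReal.ofReal ((1 + p * C / (1 - p)) * I ^ p) := by
    calc _ = ∫⁻ x, Filter.liminf (fun J : ℕ => ENNReal.ofReal
            (‖multOp (fun ξ => σ ξ * freqCutoff (2 ^ J) ξ) f x‖ ^ p)) Filter.atTop ∂μT n :=
          lintegral_congr fun x => (Filter.Tendsto.liminf_eq (ENNReal.tendsto_ofReal
            ((hlim x).norm.rpow_const (Or.inr hp0.le)))).symm
      _ ≤ Filter.liminf (fun J : ℕ => ∫⁻ x, ENNReal.ofReal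
            (‖multOp (fun ξ => σ ξ * freqCutoff (2 ^ J) ξ) f x‖ ^ p) ∂μT n) Filter.atTop :=
          lintegral_liminf_le fun J => ((hm J).norm.pow_const p).ennreal_ofReal
      _ ≤ Filter.liminf (fun _ : ℕ => ENNReal.ofReal ((1 + p * C / (1 - p)) * I ^ p))
            Filter.atTop :=
          Filter.liminf_le_liminf (Filter.Eventually.of_forall fun J =>
            lintegral_rpow_le_of_weak_type hp0 hp1 hC hI (hm J).norm (fun x => norm_nonneg _) (h J))
      _ = _ := Filter.liminf_const _
  rw [lpT, integral_eq_lintegral_of_nonneg_ae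
    (Filter.Eventually.of_forall fun x => rpow_nonneg (norm_nonneg _) _)
    (hOp.norm.pow_const p).aestronglyMeasurable]
  calc _ ≤ ((1 + p * C / (1 - p)) * I ^ p) ^ (1 / p) :=
        rpow_le_rpow toReal_nonneg (toReal_le_of_le_ofReal (by positivity) key) (by positivity)
    _ = _ := by
        rw [mul_rpow hK (by positivity), ← rpow_mul hI, mul_one_div_cancel hp0.ne', Real.rpow_one]

end

/-- **Theorem IC.** If a symbol `σ : ℤⁿ → ℂ` satisfies `|Δ_ξ^α σ(ξ)| ≤ C_α ⟨ξ⟩^{-|α|}`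
for `|α| ≤ [n/2]+1`, then the periodic Fourier multiplier `σ(D)` is bounded from
`L¹(𝕋ⁿ)` into `L^p(𝕋ⁿ)` for every `0 < p < 1`. -/
theorem periodic_multiplier_L1_to_Lp_bounded
    (n : ℕ) (hn : 1 ≤ n)
    (σ : (Fin n → ℤ) → ℂ)
    (hσ : ∀ α : Fin n → ℕ, (∑ j, α j) ≤ n / 2 + 1 →
      ∃ C : ℝ, 0 < C ∧ ∀ ξ : Fin n → ℤ, ‖ddM α σ ξ‖ ≤ C * jb ξ ^ (-(∑ j, (α j : ℝ)))) :
    ∀ p : ℝ, 0 < p → p < 1 →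
      ∃ C : ℝ, 0 < C ∧ ∀ f : (Fin n → ℝ) → ℂ, ContDiff ℝ (⊤ : ℕ∞) f → Per f →
        lpT n p (Op (fun _ => σ) f) ≤ C * lpT n 1 f := by
  intro p hp0 hp1
  obtain ⟨A, hA, hσA, hσd⟩ := exists_uniform_symbol_bound hσ
  obtain ⟨B, hB, hloc⟩ := exists_isLocalizedSymbol_mul_freqPiece hA hσd
  obtain ⟨C, hC, hweak⟩ := exists_weak_type hn (by lia) hσA hB hloc
  have hK : 0 ≤ p * C / (1 - p) := div_nonneg (by positivity) (by linarith)
  refine ⟨(1 + p * C / (1 - p)) ^ (1 / p), by positivity, fun f hf _ => ?_⟩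
  have hI : lpT n 1 f = ∫ x, ‖f x‖ ∂μT n := by simp [lpT]
  rw [hI]
  exact lpT_Op_le hp0 hp1 hC.le (integral_nonneg fun x => norm_nonneg _)
    fun J => hweak J f hf.continuous
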